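/- arXiv:1201.5471 — 2 statements merged into one kernel-verified Lean document; each statement's English description precedes it below -/
import Mathlib

section
/- Let Y be a real Banach space, F ⊆ Y and A ⊆ Y* bounded sets. If every y* ∈ aco_∞(cl_{w*}(A)) ⊆ Y* attains its supremum on F, then F|_{cl_{w*}(aco(A))} is relatively compact and relatively sequentially compact in C(cl_{w*}(aco(A))) with the topology of pointwise convergence. -/
open Filter Topology Metric Bornology

noncomputable section

variable {X : Type*} [NormedAddCommGroup X] [NormedSpace ℝ X]

/-- Topology of pointwise convergence on a set `D` of functionals. -/
def ptwTop (D : Set (X →L[ℝ] ℝ)) : TopologicalSpace X :=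
  TopologicalSpace.induced (fun x (d : D) => (d : X →L[ℝ] ℝ) x) Pi.topologicalSpace

/-- Weak-star topology on the dual of `X`. -/
def wstarTop (X : Type*) [NormedAddCommGroup X] [NormedSpace ℝ X] :
    TopologicalSpace (X →L[ℝ] ℝ) :=
  TopologicalSpace.induced (fun f (x : X) => f x) Pi.topologicalSpace

/-- Weak-star closure of a set of functionals. -/
def wstarClosure (A : Set (X →L[ℝ] ℝ)) : Set (X →L[ℝ] ℝ) :=
  @closure _ (wstarTop X) A

/-- Weak topology on `X`. -/
def weakTop (X : Type*) [NormedAddCommGroup X] [NormedSpace ℝ X] :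
    TopologicalSpace X :=
  TopologicalSpace.induced (fun x (f : X →L[ℝ] ℝ) => f x) Pi.topologicalSpace

/-- `aco_∞(A)`: absolutely convex series combinations of elements of `A`. -/
def acoInf (A : Set X) : Set X :=
  {x | ∃ (α : ℕ → ℝ) (u : ℕ → X), (∀ n, u n ∈ A) ∧ Summable (fun n => |α n|) ∧
    (∑' n, |α n|) = 1 ∧ HasSum (fun n => α n • u n) x}

/-- absolutely convex hull -/
def aco (A : Set X) : Set X := convexHull ℝ (A ∪ -A)

/-- subspace topology -/
def subTop {α : Type*} (t : TopologicalSpace α) (s : Set α) : TopologicalSpace s :=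
  TopologicalSpace.induced (Subtype.val : s → α) t

variable {Y : Type*} [NormedAddCommGroup Y] [NormedSpace ℝ Y]

/-- The space `C(K)` of pointwise-topology-continuous real functions on a subset
`K` of the dual, `K` carrying the weak* subspace topology. -/
def CK (K : Set (Y →L[ℝ] ℝ)) : Type _ :=
  {g : K → ℝ // @Continuous _ _ (subTop (wstarTop Y) K) _ g}

/-- `C(K)` carries the topology of pointwise convergence `τ_p`. -/
instance (K : Set (Y →L[ℝ] ℝ)) : TopologicalSpace (CK K) :=
  TopologicalSpace.induced (fun h : CK K => h.1) Pi.topologicalSpace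

/-- The set of restrictions `F|_K` of elements of `F ⊆ Y` to `K ⊆ Y*`,
viewed inside `C(K)`. -/
def resSet (F : Set Y) (K : Set (Y →L[ℝ] ℝ)) : Set (CK K) :=
  {h | ∃ f ∈ F, ∀ g : K, h.1 g = (g : Y →L[ℝ] ℝ) f}

theorem false_of_strict_increase {α : Type*} (r : α → α → Prop) (hrefl : ∀ a, r a a)
    (htrans : ∀ a b c, r a b → r b c → r a c) (σ : α → ℝ) (hσ : ∀ a b, r a b → σ a ≤ σ b)
    (a₀ : α) (M : ℝ) (hM : ∀ a, r a₀ a → σ a ≤ M)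
    (hub : ∀ u : ℕ → α, r a₀ (u 0) → (∀ n, r (u n) (u (n + 1))) → ∃ b, ∀ n, r (u n) b)
    (hinc : ∀ a, ∃ b, r a b ∧ σ a < σ b) : False := by
  have hnext : ∀ a : {a // r a₀ a}, ∃ b : {a // r a₀ a}, r a b ∧
      ∀ c, r a c → σ c ≤ 2 * σ b - σ a := by
    intro a
    have hne : (σ '' {c | r a c}).Nonempty := ⟨_, a, hrefl _, rfl⟩
    have hbdd : BddAbove (σ '' {c | r a c}) := by
      refine ⟨M, ?_⟩
      rintro _ ⟨c, hc, rfl⟩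
      exact hM c (htrans _ _ _ a.2 hc)
    obtain ⟨b₀, hb₀, hlt⟩ := hinc a
    have h1 : σ b₀ ≤ sSup (σ '' {c | r a c}) := le_csSup hbdd ⟨_, hb₀, rfl⟩
    obtain ⟨_, ⟨b, hb, rfl⟩, hb'⟩ := exists_lt_of_lt_csSup hne
      (show (σ a + sSup (σ '' {c | r a c})) / 2 < sSup (σ '' {c | r a c}) by linarith)
    refine ⟨⟨b, htrans _ _ _ a.2 hb⟩, hb, fun c hc => ?_⟩
    have h2 : σ c ≤ sSup (σ '' {c | r a c}) := le_csSup hbdd ⟨_, hc, rfl⟩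
    linarith
  choose f hf hf' using hnext
  let u : ℕ → {a // r a₀ a} := fun n => Nat.rec ⟨a₀, hrefl a₀⟩ (fun _ a => f a) n
  have hu : ∀ n, u (n + 1) = f (u n) := fun n => rfl
  have hstep : ∀ n, r (u n).1 (u (n + 1)).1 := fun n => by rw [hu]; exact hf _
  obtain ⟨b, hb⟩ := hub (fun n => (u n).1) (hrefl a₀) hstep
  obtain ⟨c, hc, hlt⟩ := hinc b
  have hmono : Monotone fun n => σ (u n).1 := monotone_nat_of_le_succ fun n => by
    rw [hu]; exact hσ _ _ (hf _)
  have hbd : BddAbove (Set.range fun n => σ (u n).1) := by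
    refine ⟨M, ?_⟩
    rintro _ ⟨n, rfl⟩
    exact hM _ (u n).2
  have ht := tendsto_atTop_ciSup hmono hbd
  have ht' := ht.comp (tendsto_add_atTop_nat 1)
  have h1 : σ c ≤ 2 * (⨆ n, σ (u n).1) - ⨆ n, σ (u n).1 := by
    refine ge_of_tendsto ((ht'.const_mul 2).sub ht) (Eventually.of_forall fun n => ?_)
    simp only [Function.comp, hu]
    exact hf' _ _ (htrans _ _ _ (hb n) hc)
  have h2 : (⨆ n, σ (u n).1) ≤ σ b := ciSup_le fun n => hσ _ _ (hb n)
  linarith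

theorem not_coercive_of_small_increments (P : (ℕ → ℝ) → ℝ) (C θ η : ℝ) (hη : η < θ)
    (hlip : ∀ a b : ℕ → ℝ, 0 ≤ a → 0 ≤ b → Summable a → Summable b →
      |P a - P b| ≤ C * ∑' i, |a i - b i|)
    (hlow : ∀ a : ℕ → ℝ, 0 ≤ a → Summable a → θ * ∑' i, a i ≤ P a)
    (hinc : ∀ a : ℕ → ℝ, 0 ≤ a → Summable a →
      ∃ i, ∃ ρ > 0, P (a + Pi.single i ρ) ≤ P a + η * ρ) : False := by
  let α := {a : ℕ → ℝ // (0 : ℕ → ℝ) ≤ a ∧ Summable a}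
  let σ : α → ℝ := fun a => ∑' i, a.1 i
  let r : α → α → Prop := fun a b => a.1 ≤ b.1 ∧ P b.1 ≤ P a.1 + η * (σ b - σ a)
  have hσ : ∀ a b, r a b → σ a ≤ σ b := fun a b h => a.2.2.tsum_le_tsum h.1 b.2.2
  have hbound : ∀ a, r ⟨0, le_rfl, summable_zero⟩ a → σ a ≤ P 0 / (θ - η) := by
    intro a ha
    have h1 := hlow a.1 a.2.1 a.2.2
    have h2 := ha.2
    have h3 : σ ⟨0, le_rfl, summable_zero⟩ = 0 := by simp [σ]
    rw [h3] at h2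
    rw [le_div_iff₀ (by linarith)]
    change θ * σ a ≤ _ at h1
    simp only at h2
    linarith
  refine false_of_strict_increase r (fun a => ⟨le_rfl, by simp⟩) ?_ σ hσ
    ⟨0, le_rfl, summable_zero⟩ _ hbound ?_ ?_
  · intro a b c hab hbc
    refine ⟨hab.1.trans hbc.1, ?_⟩
    have := hab.2
    have := hbc.2
    linarith
  · intro u hu0 hu
    have htr : ∀ a b c, r a b → r b c → r a c := by
      intro a b c hab hbc
      refine ⟨hab.1.trans hbc.1, ?_⟩
      have := hab.2
      have := hbc.2
      linarith
    have hmono : ∀ m n, m ≤ n → r (u m) (u n) := by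
      intro m n hmn
      induction n, hmn using Nat.le_induction with
      | base => exact ⟨le_rfl, by simp⟩
      | succ n hn ih => exact htr _ _ _ ih (hu n)
    have hub : ∀ n, σ (u n) ≤ P 0 / (θ - η) := fun n =>
      hbound _ (htr _ _ _ hu0 (hmono 0 n (Nat.zero_le _)))
    have hfin : ∀ n (s : Finset ℕ), ∑ i ∈ s, (u n).1 i ≤ P 0 / (θ - η) := fun n s =>
      ((u n).2.2.sum_le_tsum s fun i _ => (u n).2.1 i).trans (hub n)
    have hbd : ∀ i, BddAbove (Set.range fun n => (u n).1 i) := by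
      intro i
      refine ⟨P 0 / (θ - η), ?_⟩
      rintro _ ⟨n, rfl⟩
      simpa using hfin n {i}
    have hlim : ∀ i, Tendsto (fun n => (u n).1 i) atTop (𝓝 (⨆ n, (u n).1 i)) := fun i =>
      tendsto_atTop_ciSup (fun m n hmn => (hmono m n hmn).1 i) (hbd i)
    let b : ℕ → ℝ := fun i => ⨆ n, (u n).1 i
    have hle : ∀ n, (u n).1 ≤ b := fun n i => le_ciSup (hbd i) n
    have hb0 : 0 ≤ b := (u 0).2.1.trans (hle 0)
    have hbs : Summable b := by
      refine summable_of_sum_le hb0 (c := P 0 / (θ - η)) fun s => ?_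
      exact le_of_tendsto (tendsto_finsetSum s fun i _ => hlim i)
        (Eventually.of_forall fun n => hfin n s)
    have hσlim : Tendsto (fun n => σ (u n)) atTop (𝓝 (∑' i, b i)) := by
      refine tendsto_tsum_of_dominated_convergence hbs hlim
        (Eventually.of_forall fun n i => ?_)
      rw [Real.norm_of_nonneg ((u n).2.1 i)]
      exact hle n i
    refine ⟨⟨b, hb0, hbs⟩, fun n => ⟨hle n, ?_⟩⟩
    have hPlim : Tendsto (fun m => P (u m).1) atTop (𝓝 (P b)) := by
      rw [tendsto_iff_norm_sub_tendsto_zero]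
      have h0 : Tendsto (fun m => C * ((∑' i, b i) - σ (u m))) atTop (𝓝 0) := by
        have h := (hσlim.const_sub (∑' i, b i)).const_mul C
        rwa [sub_self, mul_zero] at h
      refine squeeze_zero (fun _ => norm_nonneg _) (fun m => ?_) h0
      refine (hlip _ _ (u m).2.1 hb0 (u m).2.2 hbs).trans_eq ?_
      rw [← hbs.tsum_sub (u m).2.2]
      congr 1
      refine tsum_congr fun i => ?_
      rw [abs_sub_comm, abs_of_nonneg (sub_nonneg.2 (hle m i))]
    refine le_of_tendsto_of_tendsto hPlim
      (((hσlim.sub_const (σ (u n))).const_mul η).const_add (P (u n).1)) ?_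
    filter_upwards [eventually_ge_atTop n] with m hm
    exact (hmono n m hm).2
  · rintro ⟨a, ha0, has⟩
    obtain ⟨i, ρ, hρ, h⟩ := hinc a ha0 has
    have hs : HasSum (Pi.single i ρ : ℕ → ℝ) ρ := hasSum_pi_single i ρ
    have hnn : (0 : ℕ → ℝ) ≤ Pi.single i ρ := Pi.single_nonneg.2 hρ.le
    have hsum : HasSum (a + Pi.single i ρ) ((∑' j, a j) + ρ) := has.hasSum.add hs
    have hnn' : (0 : ℕ → ℝ) ≤ a + Pi.single i ρ := fun j => add_nonneg (ha0 j) (hnn j)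
    have hle : a ≤ a + Pi.single i ρ := fun j => le_add_of_nonneg_right (hnn j)
    generalize a + Pi.single i ρ = c at *
    refine ⟨⟨c, hnn', hsum.summable⟩, ⟨hle, ?_⟩, ?_⟩
    · simp only [σ, hsum.tsum_eq, add_sub_cancel_left]
      exact h
    · simp only [σ, hsum.tsum_eq]
      linarith

theorem exists_measure_shift_invariant (N : ℕ) :
    ∃ μ : MeasureTheory.Measure (ℕ → Fin (N + 1)), MeasureTheory.IsProbabilityMeasure μ ∧
      (∀ i, MeasureTheory.MeasurePreserving (fun ω => Function.update ω i (ω i + 1)) μ μ) ∧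
      ∀ i, μ.real {ω | ω i = Fin.last N} = 1 / (N + 1) := by
  let ν : MeasureTheory.Measure (Fin (N + 1)) := (PMF.uniformOfFintype (Fin (N + 1))).toMeasure
  have hν : MeasureTheory.IsProbabilityMeasure ν := inferInstance
  have hmap : ν.map (fun x => x + 1) = ν := by
    refine MeasureTheory.Measure.ext_of_singleton fun x => ?_
    rw [MeasureTheory.Measure.map_apply (measurable_of_finite _) (MeasurableSet.singleton _)]
    have h : (fun y : Fin (N + 1) => y + 1) ⁻¹' {x} = {x - 1} := by
      ext y
      simp only [Set.mem_preimage, Set.mem_singleton_iff, eq_sub_iff_add_eq]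
    rw [h]
    simp [ν]
  refine ⟨MeasureTheory.Measure.infinitePi fun _ => ν, inferInstance, fun i => ?_, fun i => ?_⟩
  · let f : ℕ → Fin (N + 1) → Fin (N + 1) := fun j x => if j = i then x + 1 else x
    have hf : (fun ω : ℕ → Fin (N + 1) => Function.update ω i (ω i + 1)) =
        fun ω j => f j (ω j) := by
      ext ω j
      by_cases h : j = i
      · subst h; simp [f]
      · simp [f, h]
    rw [hf]
    refine ⟨by fun_prop, ?_⟩
    rw [MeasureTheory.Measure.infinitePi_map_pi _ fun j => measurable_of_finite _]
    congr 1
    funext j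
    by_cases h : j = i
    · simpa [f, h] using hmap
    · simp [f, h]
  · have h : {ω : ℕ → Fin (N + 1) | ω i = Fin.last N} = (fun ω => ω i) ⁻¹' {Fin.last N} := rfl
    rw [MeasureTheory.Measure.real, h, ← MeasureTheory.Measure.map_apply (by fun_prop)
      (MeasurableSet.singleton _), MeasureTheory.Measure.infinitePi_map_eval]
    simp [ν, ENNReal.toReal_inv]
    norm_cast

open MeasureTheory in
theorem not_coercive_of_small_derivative (P : (ℕ → ℝ) → ℝ) (C θ : ℝ) (hC : 0 ≤ C) (hθ : 0 < θ)
    (hlip : ∀ a b : ℕ → ℝ, 0 ≤ a → 0 ≤ b → Summable a → Summable b →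
      |P a - P b| ≤ C * ∑' i, |a i - b i|)
    (hlow : ∀ a : ℕ → ℝ, 0 ≤ a → Summable a → θ * ∑' i, a i ≤ P a)
    (hder : ∀ b r : ℕ → ℝ, (∀ i, 0 < r i) → (∀ i, r i ≤ b i) → Summable b → ∀ ε > 0,
      ∀ᶠ i in atTop, P b - P (b - Pi.single i (r i)) ≤ ε * r i) : False := by
  obtain ⟨N, hN⟩ := exists_nat_gt (8 * C / θ)
  obtain ⟨μ, hμ, hτ, hlast⟩ := exists_measure_shift_invariant N
  let r : ℕ → ℝ := fun i => (1 / 2) ^ i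
  have hr : ∀ i, 0 < r i := fun i => by positivity
  have hrs : Summable r := summable_geometric_two
  let κ : (ℕ → Fin (N + 1)) → ℕ → ℝ := fun ω i => r i * ((ω i : ℕ) + 1)
  have hκr : ∀ ω i, r i ≤ κ ω i := fun ω i => le_mul_of_one_le_right (hr i).le (by simp)
  have hκ0 : ∀ ω, 0 ≤ κ ω := fun ω i => (hr i).le.trans (hκr ω i)
  have hκN : ∀ ω i, κ ω i ≤ r i * (N + 1) := fun ω i => by
    refine mul_le_mul_of_nonneg_left ?_ (hr i).le
    have : ((ω i : ℕ) : ℝ) ≤ N := by exact_mod_cast Nat.lt_succ_iff.1 (ω i).2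
    linarith
  have hκs : ∀ ω, Summable (κ ω) := fun ω =>
    Summable.of_nonneg_of_le (hκ0 ω) (hκN ω) (hrs.mul_right _)
  have hκabs : ∀ ω ω' i, |κ ω i - κ ω' i| ≤ r i * (N + 1) := fun ω ω' i => by
    have := hκ0 ω i
    have := hκ0 ω' i
    simp only [Pi.zero_apply] at *
    exact abs_le.2 ⟨by linarith [hκN ω' i], by linarith [hκN ω i]⟩
  have hadd0 : ∀ a b : ℕ → ℝ, 0 ≤ a → 0 ≤ b → 0 ≤ a + b := fun a b ha hb i =>
    add_nonneg (ha i) (hb i)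
  have hcont : ∀ c : ℕ → ℝ, (∀ ω, 0 ≤ c + κ ω) → Summable c →
      Continuous fun ω => P (c + κ ω) := by
    intro c hc hcs
    rw [continuous_iff_continuousAt]
    intro ω₀
    have h1 : Continuous fun ω => C * ∑' i, |κ ω i - κ ω₀ i| := by
      refine (continuous_tsum (u := fun i => r i * (N + 1)) (fun i => ?_) (hrs.mul_right _)
        fun i ω => ?_).const_mul C
      · have : Continuous fun ω : ℕ → Fin (N + 1) => ((ω i : ℕ) : ℝ) :=
          (continuous_of_discreteTopology (f := fun x : Fin (N + 1) => ((x : ℕ) : ℝ))).comp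
            (continuous_apply i)
        fun_prop
      · rw [Real.norm_eq_abs, abs_abs]
        exact hκabs ω ω₀ i
    have h2 : Tendsto (fun ω => C * ∑' i, |κ ω i - κ ω₀ i|) (𝓝 ω₀) (𝓝 0) := by
      simpa using h1.tendsto ω₀
    rw [ContinuousAt, tendsto_iff_norm_sub_tendsto_zero]
    refine squeeze_zero (fun _ => norm_nonneg _) (fun ω => ?_) h2
    simpa using hlip (c + κ ω) (c + κ ω₀) (hc ω) (hc ω₀)
      (hcs.add (hκs ω)) (hcs.add (hκs ω₀))
  have hint : ∀ c : ℕ → ℝ, (∀ ω, 0 ≤ c + κ ω) → Summable c →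
      Integrable (fun ω => P (c + κ ω)) μ := fun c hc hcs =>
    (hcont c hc hcs).integrable_of_hasCompactSupport (HasCompactSupport.of_compactSpace _)
  refine not_coercive_of_small_increments (fun a => ∫ ω, P (a + κ ω) ∂μ) C θ (θ / 2)
    (by linarith) ?_ ?_ ?_
  · intro a b ha hb has hbs
    have ha' := fun ω => hadd0 a _ ha (hκ0 ω)
    have hb' := fun ω => hadd0 b _ hb (hκ0 ω)
    rw [← integral_sub (hint a ha' has) (hint b hb' hbs)]
    have h : ∀ ω, ‖P (a + κ ω) - P (b + κ ω)‖ ≤ C * ∑' i, |a i - b i| := fun ω => by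
      simpa using hlip (a + κ ω) (b + κ ω) (ha' ω) (hb' ω) (has.add (hκs ω)) (hbs.add (hκs ω))
    have h' := norm_integral_le_of_norm_le_const (μ := μ) (Eventually.of_forall h)
    rwa [probReal_univ, mul_one] at h'
  · intro a ha has
    have ha' := fun ω => hadd0 a _ ha (hκ0 ω)
    calc θ * ∑' i, a i = ∫ _, θ * ∑' i, a i ∂μ := by simp
      _ ≤ ∫ ω, P (a + κ ω) ∂μ := by
        refine integral_mono (integrable_const _) (hint a ha' has) fun ω => ?_
        refine le_trans ?_ (hlow _ (ha' ω) (has.add (hκs ω)))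
        refine mul_le_mul_of_nonneg_left ?_ hθ.le
        exact has.tsum_le_tsum (fun i => le_add_of_nonneg_right (hκ0 ω i)) (has.add (hκs ω))
  · intro a ha has
    have ha' := fun ω => hadd0 a _ ha (hκ0 ω)
    have hsingle : ∀ i, Summable (Pi.single i (r i) : ℕ → ℝ) := fun i =>
      (hasSum_pi_single i (r i)).summable
    have hsingle0 : ∀ i, (0 : ℕ → ℝ) ≤ Pi.single i (r i) := fun i => Pi.single_nonneg.2 (hr i).le
    have hsingle1 : ∀ i, ∑' j, |(Pi.single i (r i) : ℕ → ℝ) j| = r i := fun i => by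
      exact (tsum_congr fun j => abs_of_nonneg (hsingle0 i j)).trans (tsum_pi_single i (r i))
    have hplus : ∀ i ω, 0 ≤ a + Pi.single i (r i) + κ ω := fun i ω =>
      hadd0 _ _ (hadd0 _ _ ha (hsingle0 i)) (hκ0 ω)
    have hminus : ∀ i ω, 0 ≤ a - Pi.single i (r i) + κ ω := by
      intro i ω j
      by_cases hj : j = i
      · subst hj
        have := hκr ω j
        have := ha j
        simp only [Pi.add_apply, Pi.sub_apply, Pi.single_eq_same, Pi.zero_apply] at *
        linarith
      · have := hκ0 ω j
        have := ha j
        simp only [Pi.add_apply, Pi.sub_apply, Pi.single_eq_of_ne hj, Pi.zero_apply] at *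
        linarith
    let χ : ℕ → (ℕ → Fin (N + 1)) → ℝ := fun i ω =>
      P (a + κ ω) - P (a - Pi.single i (r i) + κ ω)
    let ψ : ℕ → (ℕ → Fin (N + 1)) → ℝ := fun i ω =>
      P (a + Pi.single i (r i) + κ ω) - P (a + κ ω)
    have hχc : ∀ i, Continuous (χ i) := fun i =>
      (hcont a ha' has).sub (hcont _ (hminus i) (has.sub (hsingle i)))
    have hψc : ∀ i, Continuous (ψ i) := fun i =>
      (hcont _ (hplus i) (has.add (hsingle i))).sub (hcont a ha' has)
    have hχb : ∀ i ω, |χ i ω| ≤ C * r i := fun i ω => by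
      refine (hlip _ _ (ha' ω) (hminus i ω) (has.add (hκs ω))
        ((has.sub (hsingle i)).add (hκs ω))).trans_eq ?_
      congr 1
      refine Eq.trans ?_ (hsingle1 i)
      simp
    have hψb : ∀ i ω, |ψ i ω| ≤ C * r i := fun i ω => by
      refine (hlip _ _ (hplus i ω) (ha' ω) ((has.add (hsingle i)).add (hκs ω))
        (has.add (hκs ω))).trans_eq ?_
      congr 1
      refine Eq.trans ?_ (hsingle1 i)
      simp
    have hlimχ : Tendsto (fun i => ∫ ω, max (χ i ω / r i) 0 ∂μ) atTop (𝓝 0) := by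
      have h := tendsto_integral_of_dominated_convergence (μ := μ)
        (F := fun i ω => max (χ i ω / r i) 0) (f := fun _ => 0) (fun _ => C)
        (fun i => (((hχc i).div_const _).max continuous_const).aestronglyMeasurable)
        (integrable_const _) (fun i => Eventually.of_forall fun ω => ?_)
        (Eventually.of_forall fun ω => ?_)
      · simpa using h
      · rw [Real.norm_of_nonneg (le_max_right _ _)]
        refine max_le ?_ hC
        rw [div_le_iff₀ (hr i)]
        exact (le_abs_self _).trans (hχb i ω)
      · rw [Metric.tendsto_nhds]
        intro ε hε
        filter_upwards [hder (a + κ ω) r hr (fun i => (hκr ω i).trans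
          (le_add_of_nonneg_left (ha i))) (has.add (hκs ω)) (ε / 2) (half_pos hε)] with i hi
        have h1 : a + κ ω - Pi.single i (r i) = a - Pi.single i (r i) + κ ω := by abel
        rw [h1] at hi
        have h2 : χ i ω / r i ≤ ε / 2 := (div_le_iff₀ (hr i)).2 hi
        rw [Real.dist_eq, sub_zero, abs_of_nonneg (le_max_right _ _)]
        exact (max_le h2 (half_pos hε).le).trans_lt (half_lt_self hε)
    obtain ⟨i, hi⟩ := (hlimχ.eventually (gt_mem_nhds (show 0 < θ / 4 by linarith))).exists
    refine ⟨i, r i, hr i, ?_⟩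
    have hint' : ∀ f : (ℕ → Fin (N + 1)) → ℝ, Continuous f → Integrable f μ := fun f hf =>
      hf.integrable_of_hasCompactSupport (HasCompactSupport.of_compactSpace _)
    have h1 : ∫ ω, χ i ω ∂μ ≤ θ / 4 * r i := by
      calc ∫ ω, χ i ω ∂μ ≤ ∫ ω, max (χ i ω / r i) 0 * r i ∂μ := by
            refine integral_mono (hint' _ (hχc i)) (hint' _
              ((((hχc i).div_const _).max continuous_const).mul_const _)) fun ω => ?_
            calc χ i ω = χ i ω / r i * r i := (div_mul_cancel₀ _ (hr i).ne').symm
              _ ≤ _ := mul_le_mul_of_nonneg_right (le_max_left _ _) (hr i).le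
        _ = (∫ ω, max (χ i ω / r i) 0 ∂μ) * r i := integral_mul_const _ _
        _ ≤ θ / 4 * r i := mul_le_mul_of_nonneg_right hi.le (hr i).le
    let τ : (ℕ → Fin (N + 1)) → (ℕ → Fin (N + 1)) := fun ω => Function.update ω i (ω i + 1)
    have hτc : Continuous τ := continuous_id.update i
      ((continuous_of_discreteTopology (f := fun x : Fin (N + 1) => x + 1)).comp
        (continuous_apply i))
    have h2 : ∫ ω, χ i (τ ω) ∂μ = ∫ ω, χ i ω ∂μ := by
      rw [← integral_map (hτ i).measurable.aemeasurable (hχc i).aestronglyMeasurable,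
        (hτ i).map_eq]
    let Z : Set (ℕ → Fin (N + 1)) := {ω | ω i = Fin.last N}
    have hZ : MeasurableSet Z := measurableSet_eq_fun (by fun_prop) (by fun_prop)
    have h3 : ∀ ω, ψ i ω ≤ χ i (τ ω) + Z.indicator (fun _ => 2 * (C * r i)) ω := by
      intro ω
      by_cases hω : ω i = Fin.last N
      · rw [Set.indicator_of_mem (show ω ∈ Z from hω)]
        have := abs_le.1 (hχb i (τ ω))
        have := abs_le.1 (hψb i ω)
        linarith
      · rw [Set.indicator_of_notMem (show ω ∉ Z from hω), add_zero]
        have h4 : κ (τ ω) = κ ω + Pi.single i (r i) := by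
          funext j
          by_cases hj : j = i
          · subst hj
            have : ((ω j + 1 : Fin (N + 1)) : ℕ) = ω j + 1 :=
              Fin.val_add_one_of_lt (Fin.lt_last_iff_ne_last.2 hω)
            simp only [κ, τ, Function.update_self, this, Pi.add_apply, Pi.single_eq_same]
            push_cast
            ring
          · simp [κ, τ, hj]
        have h5 : a + (κ ω + Pi.single i (r i)) = a + Pi.single i (r i) + κ ω := by abel
        have h6 : a - Pi.single i (r i) + (κ ω + Pi.single i (r i)) = a + κ ω := by abel
        simp only [χ, ψ, h4, h5, h6]
        exact le_rfl
    have h7 : ∫ ω, ψ i ω ∂μ ≤ θ / 4 * r i + 1 / (N + 1) * (2 * (C * r i)) := by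
      calc ∫ ω, ψ i ω ∂μ ≤ ∫ ω, (χ i (τ ω) + Z.indicator (fun _ => 2 * (C * r i)) ω) ∂μ :=
            integral_mono (hint' _ (hψc i)) ((hint' _ ((hχc i).comp hτc)).add
              ((integrable_const _).indicator hZ)) h3
        _ = ∫ ω, χ i ω ∂μ + 1 / (N + 1) * (2 * (C * r i)) := by
            rw [integral_add (hint' (fun ω => χ i (τ ω)) ((hχc i).comp hτc)) ((integrable_const _).indicator hZ), h2,
              integral_indicator_const _ hZ, hlast i, smul_eq_mul]
        _ ≤ _ := by linarith
    have h8 : ∫ ω, ψ i ω ∂μ =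
        ∫ ω, P (a + Pi.single i (r i) + κ ω) ∂μ - ∫ ω, P (a + κ ω) ∂μ :=
      integral_sub (hint _ (hplus i) (has.add (hsingle i))) (hint a ha' has)
    have h9 : 1 / ((N : ℝ) + 1) * (2 * (C * r i)) ≤ θ / 4 * r i := by
      rw [div_lt_iff₀ hθ] at hN
      rw [one_div, inv_mul_le_iff₀ (by positivity)]
      nlinarith [hr i, mul_pos hθ (hr i)]
    linarith

theorem false_of_attained_sup {S : Type*} (G : ℕ → S → ℝ) (P : (ℕ → ℝ) → ℝ) (M θ : ℝ)
    (hθ : 0 < θ) (hG : ∀ i x, |G i x| ≤ M)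
    (hlow : ∀ a : ℕ → ℝ, 0 ≤ a → Summable a → θ * ∑' i, a i ≤ P a)
    (hmax : ∀ 𝒱 : Ultrafilter ℕ, (𝒱 : Filter ℕ) ≤ atTop → ∃ w : S → ℝ,
      (∀ x, Tendsto (fun i => G i x) 𝒱 (𝓝 (w x))) ∧
      ∀ a : ℕ → ℝ, 0 ≤ a → Summable a →
        IsGreatest (Set.range fun x => ∑' i, a i * (G i x - w x)) (P a)) : False := by
  have hbd : ∀ (𝒱 : Ultrafilter ℕ) (w : S → ℝ), (∀ x, Tendsto (fun i => G i x) 𝒱 (𝓝 (w x))) →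
      ∀ i x, |G i x - w x| ≤ 2 * M := by
    intro 𝒱 w hw i x
    have h1 : |w x| ≤ M := le_of_tendsto (hw x).abs (Eventually.of_forall fun i => hG i x)
    linarith [abs_sub (G i x) (w x), hG i x]
  have hsum : ∀ (a h : ℕ → ℝ), Summable a → (∀ i, |h i| ≤ 2 * M) →
      Summable fun i => a i * h i := by
    intro a h ha hh
    refine Summable.of_norm_bounded (ha.abs.mul_right (2 * M)) fun i => ?_
    rw [norm_mul]
    exact mul_le_mul_of_nonneg_left (hh i) (abs_nonneg _)
  obtain ⟨w₀, hw₀, hP₀⟩ := hmax (hyperfilter ℕ)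
    (hyperfilter_le_cofinite.trans_eq Nat.cofinite_eq_atTop)
  have hM : 0 ≤ M := by
    obtain ⟨x, -⟩ := (hP₀ 0 le_rfl summable_zero).1
    exact (abs_nonneg _).trans (hG 0 x)
  refine not_coercive_of_small_derivative P (2 * M) θ (by linarith) hθ ?_ hlow ?_
  · have key : ∀ a b : ℕ → ℝ, 0 ≤ a → 0 ≤ b → Summable a → Summable b →
        P a - P b ≤ 2 * M * ∑' i, |a i - b i| := by
      intro a b ha hb has hbs
      obtain ⟨x, hx⟩ := (hP₀ a ha has).1
      have h1 : ∑' i, b i * (G i x - w₀ x) ≤ P b := (hP₀ b hb hbs).2 ⟨x, rfl⟩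
      have h2 := hsum a _ has fun i => hbd _ w₀ hw₀ i x
      have h3 := hsum b _ hbs fun i => hbd _ w₀ hw₀ i x
      simp only at hx
      calc P a - P b ≤ ∑' i, a i * (G i x - w₀ x) - ∑' i, b i * (G i x - w₀ x) := by
            rw [hx]; linarith
        _ = ∑' i, (a i * (G i x - w₀ x) - b i * (G i x - w₀ x)) := (h2.tsum_sub h3).symm
        _ ≤ ∑' i, 2 * M * |a i - b i| := by
            refine (h2.sub h3).tsum_le_tsum (fun i => ?_) ((has.sub hbs).abs.mul_left _)
            rw [← sub_mul]
            refine (le_abs_self _).trans ?_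
            rw [abs_mul, mul_comm]
            exact mul_le_mul_of_nonneg_right (hbd _ w₀ hw₀ i x) (abs_nonneg _)
        _ = 2 * M * ∑' i, |a i - b i| := tsum_mul_left
    intro a b ha hb has hbs
    refine abs_sub_le_iff.2 ⟨key a b ha hb has hbs, ?_⟩
    simpa only [abs_sub_comm] using key b a hb ha hbs has
  · intro b r hr hrb hbs ε hε
    by_contra hcon
    rw [not_eventually] at hcon
    have hne : (atTop ⊓ 𝓟 {i | ¬ P b - P (b - Pi.single i (r i)) ≤ ε * r i}).NeBot :=
      inf_principal_neBot_iff.2 fun U hU => (hcon.and_eventually hU).exists.imp fun i hi =>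
        ⟨hi.2, hi.1⟩
    have hle := Ultrafilter.of_le (atTop ⊓ 𝓟 {i | ¬ P b - P (b - Pi.single i (r i)) ≤ ε * r i})
    obtain ⟨w, hw, hP⟩ := hmax (Ultrafilter.of _) (hle.trans inf_le_left)
    have hb : 0 ≤ b := fun i => (hr i).le.trans (hrb i)
    obtain ⟨x, hx⟩ := (hP b hb hbs).1
    have hev := (le_principal_iff.1 (hle.trans inf_le_right))
    have h0 := (hw x).sub_const (w x)
    rw [sub_self] at h0
    obtain ⟨i, hi, hi'⟩ := ((h0.eventually (gt_mem_nhds hε)).and hev).exists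
    apply hi'
    have hsi : Summable (Pi.single i (r i) : ℕ → ℝ) := (hasSum_pi_single i (r i)).summable
    have hnn : 0 ≤ b - Pi.single i (r i) := by
      intro j
      by_cases hj : j = i
      · subst hj; simpa using hrb j
      · simpa [hj] using hb j
    have h1 : ∑' j, (b - Pi.single i (r i) : ℕ → ℝ) j * (G j x - w x) ≤
        P (b - Pi.single i (r i)) := (hP _ hnn (hbs.sub hsi)).2 ⟨x, rfl⟩
    have h2 := hsum b _ hbs fun i => hbd _ w hw i x
    have h3 : HasSum (fun j => (Pi.single i (r i) : ℕ → ℝ) j * (G j x - w x))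
        (r i * (G i x - w x)) := by
      convert! hasSum_pi_single i (r i * (G i x - w x)) using 1
      funext j
      by_cases hj : j = i
      · subst hj; simp
      · simp [hj]
    have h4 := (h2.hasSum.sub h3).tsum_eq
    simp only [Pi.sub_apply, sub_mul, h4] at h1
    simp only at hx
    rw [hx] at h1
    nlinarith [hr i, mul_le_mul_of_nonneg_left hi.le (hr i).le]

theorem exists_refinement_near_sup {S : Type*} [Nonempty S] (G : ℕ → S → ℝ) (M : ℝ)
    (hG : ∀ i x, |G i x| ≤ M) (g : S → ℝ) (B Λ : ℝ) (hg : ∀ x, g x ≤ B) (hΛ : 0 ≤ Λ)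
    (E : Set ℕ) (hE : ∃ᶠ i in atTop, i ∈ E) (ε : ℝ) (hε : 0 < ε) :
    ∃ E' ⊆ E, (∃ᶠ i in atTop, i ∈ E') ∧
      ∀ 𝒱 𝒱' : Ultrafilter ℕ, (𝒱 : Filter ℕ) ≤ atTop → (𝒱' : Filter ℕ) ≤ atTop →
        E' ∈ 𝒱 → E ∈ 𝒱' → ∀ w w' : S → ℝ, (∀ x, Tendsto (fun i => G i x) 𝒱 (𝓝 (w x))) →
          (∀ x, Tendsto (fun i => G i x) 𝒱' (𝓝 (w' x))) →
          ∀ x', ∃ x, g x' - Λ * w' x' ≤ g x - Λ * w x + ε := by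
  let T : Set ℝ := {t | ∃ (𝒱 : Ultrafilter ℕ) (w : S → ℝ) (x : S), (𝒱 : Filter ℕ) ≤ atTop ∧
    E ∈ 𝒱 ∧ (∀ x, Tendsto (fun i => G i x) 𝒱 (𝓝 (w x))) ∧ t = g x - Λ * w x}
  have hne : T.Nonempty := by
    have : (atTop ⊓ 𝓟 E).NeBot := inf_principal_neBot_iff.2 fun U hU =>
      (hE.and_eventually hU).exists.imp fun i hi => ⟨hi.2, hi.1⟩
    have hle := Ultrafilter.of_le (atTop ⊓ 𝓟 E)
    have hlim : ∀ x, ∃ l, Tendsto (fun i => G i x) (Ultrafilter.of (atTop ⊓ 𝓟 E)) (𝓝 l) := by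
      intro x
      obtain ⟨l, -, hl⟩ := (isCompact_Icc (a := -M) (b := M)).ultrafilter_le_nhds
        ((Ultrafilter.of (atTop ⊓ 𝓟 E)).map fun i => G i x)
        (tendsto_principal.2 (Eventually.of_forall fun i => abs_le.1 (hG i x)))
      exact ⟨l, hl⟩
    choose w hw using hlim
    exact ⟨_, Ultrafilter.of (atTop ⊓ 𝓟 E), w, Classical.arbitrary S, hle.trans inf_le_left,
      le_principal_iff.1 (hle.trans inf_le_right), hw, rfl⟩
  have hbdd : BddAbove T := by
    refine ⟨B + Λ * M, ?_⟩
    rintro _ ⟨𝒱, w, x, -, -, hw, rfl⟩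
    have h1 : |w x| ≤ M := le_of_tendsto (hw x).abs (Eventually.of_forall fun i => hG i x)
    have h2 := mul_le_mul_of_nonneg_left (neg_le_of_abs_le h1) hΛ
    linarith [hg x]
  obtain ⟨_, ⟨𝒱₀, w₀, x, h𝒱₀, hE₀, hw₀, rfl⟩, hlt⟩ := exists_lt_of_lt_csSup hne
    (show sSup T - ε / 2 < sSup T by linarith)
  let δ : ℝ := ε / (2 * (Λ + 1))
  have hδ : 0 < δ := by positivity
  have hΛδ : Λ * δ ≤ ε / 2 := by
    have : Λ * δ = ε / 2 * (Λ / (Λ + 1)) := by simp only [δ]; field_simp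
    rw [this]
    exact mul_le_of_le_one_right (by linarith) ((div_le_one (by linarith)).2 (by linarith))
  have hmem : {i | i ∈ E ∧ |G i x - w₀ x| < δ} ∈ 𝒱₀ := by
    have := (hw₀ x).eventually (Metric.ball_mem_nhds _ hδ)
    filter_upwards [hE₀, this] with i h1 h2
    exact ⟨h1, by simpa [Real.dist_eq] using h2⟩
  refine ⟨{i | i ∈ E ∧ |G i x - w₀ x| < δ}, fun i hi => hi.1, ?_, ?_⟩
  · exact (Eventually.frequently (f := (𝒱₀ : Filter ℕ)) hmem).filter_mono h𝒱₀
  · intro 𝒱 𝒱' h𝒱 h𝒱' hE1 hE2 w w' hw hw' x'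
    have h1 : g x' - Λ * w' x' ≤ sSup T := le_csSup hbdd ⟨𝒱', w', x', h𝒱', hE2, hw', rfl⟩
    have h2 : |w x - w₀ x| ≤ δ := by
      refine le_of_tendsto ((hw x).sub_const (w₀ x)).abs ?_
      filter_upwards [hE1] with i hi
      exact hi.2.le
    have h3 := mul_le_mul_of_nonneg_left (le_of_abs_le h2) hΛ
    exact ⟨x, by linarith⟩

theorem exists_subseq_sup_agree {S κ : Type*} [Nonempty S] [Nonempty κ] [Countable κ]
    (G : ℕ → S → ℝ) (M : ℝ) (hG : ∀ i x, |G i x| ≤ M) (g : κ → S → ℝ) (B Λ : κ → ℝ)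
    (hg : ∀ k x, g k x ≤ B k) (hΛ : ∀ k, 0 ≤ Λ k) :
    ∃ s : ℕ → ℕ, StrictMono s ∧
      ∀ 𝒱 𝒱' : Ultrafilter ℕ, (𝒱 : Filter ℕ) ≤ atTop → (𝒱' : Filter ℕ) ≤ atTop →
        ∀ w w' : S → ℝ, (∀ x, Tendsto (fun i => G (s i) x) 𝒱 (𝓝 (w x))) →
          (∀ x, Tendsto (fun i => G (s i) x) 𝒱' (𝓝 (w' x))) →
          ∀ k, ∀ ε > 0, ∀ x', ∃ x, g k x' - Λ k * w' x' ≤ g k x - Λ k * w x + ε := by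
  obtain ⟨e, he⟩ := exists_surjective_nat (κ × ℕ)
  have hstep : ∀ (n : ℕ) (E : {E : Set ℕ // ∃ᶠ i in atTop, i ∈ E}),
      ∃ E' : {E : Set ℕ // ∃ᶠ i in atTop, i ∈ E}, E'.1 ⊆ E.1 ∧
      ∀ 𝒱 𝒱' : Ultrafilter ℕ, (𝒱 : Filter ℕ) ≤ atTop → (𝒱' : Filter ℕ) ≤ atTop →
        E'.1 ∈ 𝒱 → E.1 ∈ 𝒱' → ∀ w w' : S → ℝ, (∀ x, Tendsto (fun i => G i x) 𝒱 (𝓝 (w x))) →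
          (∀ x, Tendsto (fun i => G i x) 𝒱' (𝓝 (w' x))) →
          ∀ x', ∃ x, g (e n).1 x' - Λ (e n).1 * w' x' ≤
            g (e n).1 x - Λ (e n).1 * w x + 1 / ((e n).2 + 1) := by
    intro n E
    obtain ⟨E', h1, h2, h3⟩ := exists_refinement_near_sup G M hG (g (e n).1) (B (e n).1)
      (Λ (e n).1) (hg _) (hΛ _) E.1 E.2 (1 / ((e n).2 + 1)) (by positivity)
    exact ⟨⟨E', h2⟩, h1, h3⟩
  choose f hf hf' using hstep
  let E : ℕ → {E : Set ℕ // ∃ᶠ i in atTop, i ∈ E} := fun n =>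
    Nat.rec ⟨Set.univ, (Eventually.of_forall fun i => Set.mem_univ i).frequently⟩ (fun n E => f n E) n
  have hE : ∀ n, E (n + 1) = f n (E n) := fun n => rfl
  have hanti : Antitone fun n => (E n).1 := antitone_nat_of_succ_le fun n => by
    simp only [hE]
    exact hf n (E n)
  obtain ⟨s, hs, hsE⟩ := extraction_forall_of_frequently fun n => (E n).2
  refine ⟨s, hs, fun 𝒱 𝒱' h𝒱 h𝒱' w w' hw hw' k ε hε x' => ?_⟩
  have hfree : ∀ 𝒲 : Ultrafilter ℕ, (𝒲 : Filter ℕ) ≤ atTop →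
      ((𝒲.map s : Ultrafilter ℕ) : Filter ℕ) ≤ atTop := fun 𝒲 h =>
    (map_mono h).trans hs.tendsto_atTop
  have hmem : ∀ (𝒲 : Ultrafilter ℕ), (𝒲 : Filter ℕ) ≤ atTop → ∀ n, (E n).1 ∈ 𝒲.map s := by
    intro 𝒲 h n
    refine Ultrafilter.mem_map.2 ?_
    refine Filter.mem_of_superset (h (Ici_mem_atTop n)) fun i hi => hanti hi (hsE i)
  obtain ⟨m, hm⟩ := exists_nat_one_div_lt hε
  obtain ⟨n, hn⟩ := he (k, m)
  obtain ⟨x, hx⟩ := hf' n (E n) (𝒱.map s) (𝒱'.map s) (hfree _ h𝒱) (hfree _ h𝒱')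
    (hmem _ h𝒱 (n + 1)) (hmem _ h𝒱' _) w w' (fun x => hw x) (fun x => hw' x) x'
  rw [hn] at hx
  exact ⟨x, by simp only at hx; linarith⟩

theorem exists_approx_natCast_sum (a : ℕ → ℝ) (ha : 0 ≤ a) (has : Summable a) (B ε : ℝ)
    (hε : 0 < ε) :
    ∃ (n N : ℕ) (m : ℕ → ℕ), 0 < N ∧ ∀ h : ℕ → ℝ, (∀ i, |h i| ≤ B) →
      |N * ∑' i, a i * h i - ∑ i ∈ Finset.range n, m i * h i| ≤ N * ε := by
  have ht := (tendsto_sum_nat_add a).const_mul B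
  rw [mul_zero] at ht
  obtain ⟨n, hn⟩ := (ht.eventually (gt_mem_nhds (half_pos hε))).exists
  obtain ⟨N, hN⟩ := exists_nat_gt (max 0 (2 * (n * B) / ε))
  have hN0 : (0 : ℝ) < N := (le_max_left _ _).trans_lt hN
  have hN1 : n * B ≤ N * (ε / 2) := by
    have := (le_max_right _ _).trans_lt hN
    rw [div_lt_iff₀ hε] at this
    linarith
  refine ⟨n, N, fun i => ⌊N * a i⌋₊, by exact_mod_cast hN0, fun h hh => ?_⟩
  have hs : Summable fun i => a i * h i := by
    refine Summable.of_norm_bounded (has.mul_right B) fun i => ?_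
    rw [norm_mul, Real.norm_of_nonneg (ha i)]
    exact mul_le_mul_of_nonneg_left (hh i) (ha i)
  have h1 : |∑' i, a (i + n) * h (i + n)| ≤ ε / 2 := by
    refine le_trans ?_ hn.le
    rw [← tsum_mul_left]
    rw [← Real.norm_eq_abs]
    refine tsum_of_norm_bounded (((summable_nat_add_iff n).2 has).mul_left B).hasSum fun i => ?_
    rw [norm_mul, Real.norm_of_nonneg (ha _), mul_comm]
    exact mul_le_mul_of_nonneg_right (hh _) (ha _)
  have h2 : |∑ i ∈ Finset.range n, (N * a i - ⌊N * a i⌋₊) * h i| ≤ n * B := by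
    refine (Finset.abs_sum_le_sum_abs _ _).trans ?_
    refine (Finset.sum_le_card_nsmul _ _ B fun i _ => ?_).trans_eq (by simp)
    rw [abs_mul]
    refine (mul_le_mul_of_nonneg_right ?_ (abs_nonneg _)).trans ((one_mul _).trans_le (hh i))
    rw [abs_le]
    constructor
    · linarith [Nat.floor_le (mul_nonneg hN0.le (ha i))]
    · linarith [Nat.lt_floor_add_one (N * a i)]
  have h3 : N * ∑' i, a i * h i - ∑ i ∈ Finset.range n, (⌊N * a i⌋₊ : ℝ) * h i =
      ∑ i ∈ Finset.range n, (N * a i - ⌊N * a i⌋₊) * h i + N * ∑' i, a (i + n) * h (i + n) := by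
    rw [← hs.sum_add_tsum_nat_add n, mul_add, Finset.mul_sum]
    simp only [sub_mul, Finset.sum_sub_distrib, mul_assoc]
    ring
  rw [h3]
  refine (abs_add_le _ _).trans ?_
  rw [abs_mul, abs_of_pos hN0]
  have := mul_le_mul_of_nonneg_left h1 hN0.le
  linarith

theorem exists_subseq_sup_tsum_agree {S : Type*} [Nonempty S] (G : ℕ → S → ℝ) (M : ℝ)
    (hG : ∀ i x, |G i x| ≤ M) :
    ∃ s : ℕ → ℕ, StrictMono s ∧
      ∀ 𝒱 𝒱' : Ultrafilter ℕ, (𝒱 : Filter ℕ) ≤ atTop → (𝒱' : Filter ℕ) ≤ atTop →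
        ∀ w w' : S → ℝ, (∀ x, Tendsto (fun i => G (s i) x) 𝒱 (𝓝 (w x))) →
          (∀ x, Tendsto (fun i => G (s i) x) 𝒱' (𝓝 (w' x))) →
          ∀ a : ℕ → ℝ, 0 ≤ a → Summable a → ∀ ε > 0, ∀ x', ∃ x,
            ∑' i, a i * (G (s i) x' - w' x') ≤ ∑' i, a i * (G (s i) x - w x) + ε := by
  obtain ⟨s, hs, h⟩ := exists_subseq_sup_agree (κ := Σ n, Fin n → ℕ × ℕ) G M hG
    (fun q x => ∑ i, ((q.2 i).1 : ℝ) * G (q.2 i).2 x) (fun q => ∑ i, ((q.2 i).1 : ℝ) * M)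
    (fun q => ∑ i, ((q.2 i).1 : ℝ))
    (fun q x => Finset.sum_le_sum fun i _ =>
      mul_le_mul_of_nonneg_left (le_of_abs_le (hG _ x)) (Nat.cast_nonneg _))
    (fun q => Finset.sum_nonneg fun i _ => Nat.cast_nonneg _)
  refine ⟨s, hs, fun 𝒱 𝒱' h𝒱 h𝒱' w w' hw hw' a ha has ε hε x' => ?_⟩
  have hbd : ∀ (𝒱 : Ultrafilter ℕ) (w : S → ℝ),
      (∀ x, Tendsto (fun i => G (s i) x) 𝒱 (𝓝 (w x))) → ∀ x i, |G (s i) x - w x| ≤ 2 * M := by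
    intro 𝒱 w hw x i
    have h1 : |w x| ≤ M := le_of_tendsto (hw x).abs (Eventually.of_forall fun i => hG _ x)
    linarith [abs_sub (G (s i) x) (w x), hG (s i) x]
  obtain ⟨n, N, m, hN, happ⟩ := exists_approx_natCast_sum a ha has (2 * M) (ε / 3) (by linarith)
  have hN0 : (0 : ℝ) < N := by exact_mod_cast hN
  obtain ⟨x, hx⟩ := h 𝒱 𝒱' h𝒱 h𝒱' w w' hw hw' ⟨n, fun i => (m i, s i)⟩ (N * (ε / 3))
    (by positivity) x'
  refine ⟨x, ?_⟩
  have hconv : ∀ (w : S → ℝ) x, ∑ i : Fin n, (m i : ℝ) * G (s i) x - (∑ i : Fin n, (m i : ℝ)) * w x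
      = ∑ i ∈ Finset.range n, m i * (G (s i) x - w x) := by
    intro w x
    rw [Finset.sum_mul, ← Finset.sum_sub_distrib, Finset.sum_range]
    exact Finset.sum_congr rfl fun i _ => (mul_sub _ _ _).symm
  simp only [hconv] at hx
  have h1 := abs_le.1 (happ _ (hbd 𝒱 w hw x))
  have h2 := abs_le.1 (happ _ (hbd 𝒱' w' hw' x'))
  refine le_of_mul_le_mul_left ?_ hN0
  rw [mul_add]
  linarith [h1.1, h1.2, h2.1, h2.2]

theorem false_of_attained {S : Type*} (G : ℕ → S → ℝ) (M θ : ℝ)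
    (hθ : 0 < θ) (hG : ∀ i x, |G i x| ≤ M)
    (hatt : ∀ s : ℕ → ℕ, StrictMono s → ∀ 𝒱 : Ultrafilter ℕ, (𝒱 : Filter ℕ) ≤ atTop →
      ∃ w : S → ℝ, (∀ x, Tendsto (fun i => G (s i) x) 𝒱 (𝓝 (w x))) ∧
      ∀ a : ℕ → ℝ, 0 ≤ a → Summable a → ∃ t, θ * ∑' i, a i ≤ t ∧
        IsGreatest (Set.range fun x => ∑' i, a i * (G (s i) x - w x)) t) : False := by
  have hfree := hyperfilter_le_cofinite.trans_eq Nat.cofinite_eq_atTop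
  have : Nonempty S := by
    obtain ⟨w, -, hw⟩ := hatt id strictMono_id (hyperfilter ℕ) hfree
    obtain ⟨t, -, ⟨x, -⟩, -⟩ := hw 0 le_rfl summable_zero
    exact ⟨x⟩
  obtain ⟨s, hs, hagree⟩ := exists_subseq_sup_tsum_agree G M hG
  obtain ⟨w₀, hw₀, hP₀⟩ := hatt s hs (hyperfilter ℕ) hfree
  classical
  let P : (ℕ → ℝ) → ℝ := fun a => if h : 0 ≤ a ∧ Summable a then (hP₀ a h.1 h.2).choose else 0
  have hP : ∀ a (h : 0 ≤ a) (h' : Summable a), θ * ∑' i, a i ≤ P a ∧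
      IsGreatest (Set.range fun x => ∑' i, a i * (G (s i) x - w₀ x)) (P a) := fun a h h' => by
    simp only [P, dif_pos (And.intro h h')]
    exact (hP₀ a h h').choose_spec
  refine false_of_attained_sup (fun i => G (s i)) P M θ hθ (fun i => hG _)
    (fun a h h' => (hP a h h').1) fun 𝒱 h𝒱 => ?_
  obtain ⟨w, hw, hmax⟩ := hatt s hs 𝒱 h𝒱
  refine ⟨w, hw, fun a ha has => ?_⟩
  obtain ⟨t, -, ht⟩ := hmax a ha has
  have hPt : P a = t := by
    obtain ⟨⟨x₀, hx₀⟩, hub₀⟩ := (hP a ha has).2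
    obtain ⟨⟨x, hx⟩, hub⟩ := ht
    refine le_antisymm (le_of_forall_pos_le_add fun ε hε => ?_)
      (le_of_forall_pos_le_add fun ε hε => ?_)
    · obtain ⟨y, hy⟩ := hagree 𝒱 (hyperfilter ℕ) h𝒱 hfree w w₀ hw hw₀ a ha has ε hε x₀
      have := hub ⟨y, rfl⟩
      simp only at this hx₀
      linarith
    · obtain ⟨y, hy⟩ := hagree (hyperfilter ℕ) 𝒱 hfree h𝒱 w₀ w hw₀ hw a ha has ε hε x
      have := hub₀ ⟨y, rfl⟩
      simp only at this hx
      linarith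
  rw [hPt]
  exact ht

theorem tendsto_wstarTop_iff {ι E : Type*} [NormedAddCommGroup E] [NormedSpace ℝ E]
    {l : Filter ι} {g : ι → E →L[ℝ] ℝ} {w : E →L[ℝ] ℝ} :
    Tendsto g l (@nhds _ (wstarTop E) w) ↔ ∀ y, Tendsto (fun i => g i y) l (𝓝 (w y)) := by
  rw [wstarTop, nhds_induced, tendsto_comap_iff, tendsto_pi_nhds]
  rfl

theorem subset_wstarClosure {E : Type*} [NormedAddCommGroup E] [NormedSpace ℝ E]
    (A : Set (E →L[ℝ] ℝ)) : A ⊆ wstarClosure A :=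
  @subset_closure _ (wstarTop E) A

theorem mem_wstarClosure_of_tendsto {ι E : Type*} [NormedAddCommGroup E] [NormedSpace ℝ E]
    {A : Set (E →L[ℝ] ℝ)} {l : Filter ι} [l.NeBot] {g : ι → E →L[ℝ] ℝ} {w : E →L[ℝ] ℝ}
    (hg : ∀ᶠ i in l, g i ∈ wstarClosure A) (h : ∀ y, Tendsto (fun i => g i y) l (𝓝 (w y))) :
    w ∈ wstarClosure A :=
  @IsClosed.mem_of_tendsto _ (wstarTop E) _ _ _ _ _ _ (@isClosed_closure _ (wstarTop E) A)
    (tendsto_wstarTop_iff.2 h) hg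

theorem abs_apply_le_of_mem_wstarClosure {E : Type*} [NormedAddCommGroup E] [NormedSpace ℝ E]
    {A : Set (E →L[ℝ] ℝ)} {y : E} {c : ℝ} (h : ∀ a ∈ A, |a y| ≤ c) {k : E →L[ℝ] ℝ}
    (hk : k ∈ wstarClosure A) : |k y| ≤ c := by
  obtain ⟨u, hA, hu⟩ := (@mem_closure_iff_ultrafilter _ _ _ (wstarTop E)).1 hk
  exact le_of_tendsto (tendsto_wstarTop_iff.1 (tendsto_id'.2 hu) y).abs
    (Filter.mem_of_superset hA h)

theorem abs_apply_le_of_mem_aco {E : Type*} [NormedAddCommGroup E] [NormedSpace ℝ E]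
    {A : Set (E →L[ℝ] ℝ)} {y : E} {c : ℝ} (h : ∀ a ∈ A, |a y| ≤ c) {k : E →L[ℝ] ℝ}
    (hk : k ∈ aco A) : |k y| ≤ c := by
  have hconv : Convex ℝ {k : E →L[ℝ] ℝ | k y ∈ Set.Icc (-c) c} :=
    (convex_Icc (-c) c).is_linear_preimage ⟨fun _ _ => rfl, fun _ _ => rfl⟩
  refine abs_le.2 (convexHull_min ?_ hconv hk)
  rintro a (ha | ha)
  · exact abs_le.1 (h a ha)
  · have := h _ ha
    rw [neg_apply, abs_neg] at this
    exact abs_le.1 this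

theorem exists_bound_of_isBounded {E : Type*} [NormedAddCommGroup E] [NormedSpace ℝ E]
    {A : Set (E →L[ℝ] ℝ)} (hA : IsBounded A) :
    ∃ R, 0 ≤ R ∧ ∀ k ∈ wstarClosure A, ∀ y, |k y| ≤ R * ‖y‖ := by
  obtain ⟨R, hR0, hR⟩ := hA.exists_pos_norm_le
  refine ⟨R, hR0.le, fun k hk y => abs_apply_le_of_mem_wstarClosure (fun a ha => ?_) hk⟩
  exact (a.le_opNorm y).trans (mul_le_mul_of_nonneg_right (hR a ha) (norm_nonneg _))

theorem isBounded_aco {E : Type*} [NormedAddCommGroup E] [NormedSpace ℝ E]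
    {A : Set E} (hA : IsBounded A) : IsBounded (aco A) :=
  isBounded_convexHull.2 (hA.union (by simpa using hA.neg))

theorem exists_tendsto_of_mem_wstarClosure {ι E : Type*} [NormedAddCommGroup E]
    [NormedSpace ℝ E] {A : Set (E →L[ℝ] ℝ)} (hA : IsBounded A) (𝒱 : Ultrafilter ι)
    (g : ι → E →L[ℝ] ℝ) (hg : ∀ i, g i ∈ wstarClosure A) :
    ∃ w ∈ wstarClosure A, ∀ y, Tendsto (fun i => g i y) 𝒱 (𝓝 (w y)) := by
  obtain ⟨R, hR0, hR⟩ := exists_bound_of_isBounded hA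
  have hlim : ∀ y, ∃ l, Tendsto (fun i => g i y) 𝒱 (𝓝 l) := by
    intro y
    obtain ⟨l, -, hl⟩ := (isCompact_Icc (a := -(R * ‖y‖)) (b := R * ‖y‖)).ultrafilter_le_nhds
      (𝒱.map fun i => g i y)
      (tendsto_principal.2 (Eventually.of_forall fun i => abs_le.1 (hR _ (hg i) y)))
    exact ⟨l, hl⟩
  choose w hw using hlim
  let w' : E →ₗ[ℝ] ℝ :=
    { toFun := w
      map_add' := fun x y => tendsto_nhds_unique (hw (x + y)) (by simpa using (hw x).add (hw y))
      map_smul' := fun c x => tendsto_nhds_unique (hw (c • x))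
        (by simpa using (hw x).const_mul c) }
  have hw' : ∀ y, ‖w' y‖ ≤ R * ‖y‖ := fun y =>
    le_of_tendsto (hw y).abs (Eventually.of_forall fun i => hR _ (hg i) y)
  exact ⟨w'.mkContinuous R hw',
    mem_wstarClosure_of_tendsto (Eventually.of_forall hg) (w := w'.mkContinuous R hw') hw, hw⟩

theorem nhds_subTop_wstarTop {E : Type*} [NormedAddCommGroup E] [NormedSpace ℝ E]
    {Z : Set (E →L[ℝ] ℝ)} {l : Filter Z} {k₀ : Z} :
    l ≤ @nhds _ (subTop (wstarTop E) Z) k₀ ↔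
      ∀ y, Tendsto (fun k : Z => k.1 y) l (𝓝 (k₀.1 y)) := by
  rw [subTop, @nhds_induced _ _ (wstarTop E), ← tendsto_iff_comap, tendsto_wstarTop_iff]

theorem continuous_subTop_iff {E : Type*} [NormedAddCommGroup E] [NormedSpace ℝ E]
    {Z : Set (E →L[ℝ] ℝ)} {φ : Z → ℝ} :
    @Continuous _ _ (subTop (wstarTop E) Z) _ φ ↔ ∀ (k₀ : Z) (𝒱 : Ultrafilter Z),
      (∀ y, Tendsto (fun k : Z => k.1 y) 𝒱 (𝓝 (k₀.1 y))) → Tendsto φ 𝒱 (𝓝 (φ k₀)) := by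
  let _ := subTop (wstarTop E) Z
  rw [continuous_iff_ultrafilter]
  exact forall_congr' fun k₀ => forall_congr' fun 𝒱 => imp_congr_left nhds_subTop_wstarTop

theorem exists_double_limit_sequences {E : Type*} [NormedAddCommGroup E] [NormedSpace ℝ E]
    (F : Set E) (Z : Set (E →L[ℝ] ℝ)) (φ : Z → ℝ)
    (happ : ∀ (T : Finset Z) (ε : ℝ), 0 < ε → ∃ f ∈ F, ∀ k ∈ T, |k.1 f - φ k| < ε)
    (hφ : ¬ @Continuous _ _ (subTop (wstarTop E) Z) _ φ) :
    ∃ (f : ℕ → E) (g : ℕ → Z) (k₀ : Z) (ε : ℝ), 0 < ε ∧ (∀ n, f n ∈ F) ∧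
      (∀ m, ε ≤ |φ (g m) - φ k₀|) ∧
      (∀ m, Tendsto (fun n => (g m).1 (f n)) atTop (𝓝 (φ (g m)))) ∧
      (∀ n, Tendsto (fun m => (g m).1 (f n)) atTop (𝓝 (k₀.1 (f n)))) ∧
      Tendsto (fun n => k₀.1 (f n)) atTop (𝓝 (φ k₀)) := by
  classical
  rw [continuous_subTop_iff] at hφ
  push Not at hφ
  obtain ⟨k₀, 𝒱, h𝒱, hnot⟩ := hφ
  rw [Metric.tendsto_nhds] at hnot
  push Not at hnot
  obtain ⟨ε, hε, hnot⟩ := hnot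
  have hfar : ∀ᶠ k : Z in 𝒱, ε ≤ |φ k - φ k₀| := by
    simpa [Real.dist_eq] using hnot
  obtain ⟨x, hxP, hxr⟩ := exists_seq_of_forall_finset_exists
    (fun p : E × Z × ℕ => p.1 ∈ F ∧ ε ≤ |φ p.2.1 - φ k₀| ∧ |k₀.1 p.1 - φ k₀| < 1 / (p.2.2 + 1))
    (fun p q : E × Z × ℕ => p.2.2 < q.2.2 ∧ |p.2.1.1 q.1 - φ p.2.1| < 1 / (q.2.2 + 1) ∧
      |q.2.1.1 p.1 - k₀.1 p.1| < 1 / (q.2.2 + 1)) (by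
    intro s _
    let n : ℕ := s.sup (fun p => p.2.2) + 1
    have hn : (0 : ℝ) < 1 / (n + 1) := by positivity
    obtain ⟨f, hf, hf'⟩ := happ (insert k₀ (s.image fun p => p.2.1)) _ hn
    have hev : ∀ᶠ k : Z in 𝒱, ∀ p ∈ s, |k.1 p.1 - k₀.1 p.1| < 1 / ((n : ℝ) + 1) := by
      refine (Filter.eventually_all_finset s).2 fun p _ => ?_
      filter_upwards [(h𝒱 p.1).eventually (Metric.ball_mem_nhds _ hn)] with k hk
      simpa [Real.dist_eq] using hk
    obtain ⟨g, hg, hg'⟩ := (hfar.and hev).exists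
    refine ⟨(f, g, n), ⟨hf, hg, hf' _ (Finset.mem_insert_self _ _)⟩, fun p hp => ⟨?_, ?_, ?_⟩⟩
    · exact Nat.lt_succ_of_le (Finset.le_sup (f := fun p : E × Z × ℕ => p.2.2) hp)
    · exact hf' _ (Finset.mem_insert_of_mem (Finset.mem_image_of_mem _ hp))
    · exact hg' p hp)
  have hmono : StrictMono fun n => (x n).2.2 := fun m n h => (hxr m n h).1
  have hsmall : ∀ n, 1 / (((x n).2.2 : ℝ) + 1) ≤ 1 / ((n : ℝ) + 1) := fun n =>
    one_div_le_one_div_of_le (by positivity) (by exact_mod_cast Nat.succ_le_succ (hmono.le_apply))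
  have hlim : ∀ (u : ℕ → ℝ) (c : ℝ), (∀ᶠ n in atTop, |u n - c| < 1 / ((x n).2.2 + 1)) →
      Tendsto u atTop (𝓝 c) := by
    intro u c h
    rw [tendsto_iff_norm_sub_tendsto_zero]
    refine squeeze_zero' (Eventually.of_forall fun _ => norm_nonneg _) ?_
      tendsto_one_div_add_atTop_nhds_zero_nat
    filter_upwards [h] with n hn
    exact hn.le.trans (hsmall n)
  refine ⟨fun n => (x n).1, fun n => (x n).2.1, k₀, ε, hε, fun n => (hxP n).1,
    fun m => (hxP m).2.1, fun m => hlim _ _ ?_, fun n => hlim _ _ ?_,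
    hlim _ _ (Eventually.of_forall fun n => (hxP n).2.2)⟩
  · filter_upwards [eventually_gt_atTop m] with n hn
    exact (hxr m n hn).2.1
  · filter_upwards [eventually_gt_atTop n] with m hm
    exact (hxr n m hm).2.2

theorem exists_isGreatest_of_attained {E : Type*} [NormedAddCommGroup E] [NormedSpace ℝ E]
    {F : Set E} {B : Set (E →L[ℝ] ℝ)} (hF : IsBounded F) (hne : F.Nonempty) {R : ℝ}
    (hR : ∀ k ∈ B, ∀ y, |k y| ≤ R * ‖y‖) (hR0 : 0 ≤ R)
    (hattain : ∀ y' ∈ acoInf B, ∃ f₀ ∈ F, y' f₀ = sSup ((fun f => y' f) '' F))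
    {g : ℕ → E →L[ℝ] ℝ} (hg : ∀ i, g i ∈ B) {w : E →L[ℝ] ℝ} (hw : w ∈ B) {e : ℝ}
    (he : |e| = 1) {a : ℕ → ℝ} (ha : ∀ i, 0 ≤ a i) (hsum : Summable a) :
    ∃ t, IsGreatest (Set.range fun x : F => ∑' i, a i * (e * g i x - e * w x)) t := by
  obtain hσ | hσ := (tsum_nonneg ha).eq_or_lt
  · have h0 : a = 0 := (hasSum_zero_iff_of_nonneg ha).1 (hσ ▸ hsum.hasSum)
    have : Nonempty F := hne.to_subtype
    exact ⟨0, by simp [h0, Set.range_const]⟩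
  set σ := ∑' i, a i
  let α : ℕ → ℝ := fun n => n.casesOn (-e / 2) fun i => e * a i / (2 * σ)
  let u : ℕ → E →L[ℝ] ℝ := fun n => n.casesOn w g
  have hu : ∀ n, u n ∈ B := fun n => by cases n with
    | zero => exact hw
    | succ n => exact hg n
  have hαs : ∀ n, |α (n + 1)| = a n * (1 / (2 * σ)) := fun n => by
    change |e * a n / (2 * σ)| = _
    rw [abs_div, abs_mul, he, abs_of_nonneg (ha n), abs_of_pos (by positivity : 0 < 2 * σ)]
    ring
  have hα0 : |α 0| = 1 / 2 := by
    change |-e / 2| = _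
    rw [abs_div, abs_neg, he, abs_two]
  have hαsum : HasSum (fun n => |α n|) 1 := by
    rw [← hasSum_nat_add_iff' 1]
    simp only [hαs, Finset.sum_range_one, hα0]
    rw [show (1 : ℝ) - 1 / 2 = σ * (1 / (2 * σ)) by field_simp; norm_num]
    exact hsum.hasSum.mul_right _
  have hnorm : ∀ n, ‖u n‖ ≤ R := fun n =>
    (u n).opNorm_le_bound hR0 fun y => hR _ (hu n) y
  have hsummable : Summable fun n => α n • u n := by
    refine Summable.of_norm_bounded (hαsum.summable.mul_right R) fun n => ?_
    rw [norm_smul]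
    exact mul_le_mul_of_nonneg_left (hnorm n) (abs_nonneg _)
  obtain ⟨y', hy'⟩ := hsummable
  obtain ⟨f₀, hf₀, hmax⟩ := hattain y' ⟨α, u, hu, hαsum.summable, hαsum.tsum_eq, hy'⟩
  have hval : ∀ x, ∑' i, a i * (e * g i x - e * w x) = 2 * σ * y' x := by
    intro x
    have h1 : HasSum (fun n => α n * u n x) (y' x) := by
      simpa using hy'.mapL (ContinuousLinearMap.apply ℝ ℝ x)
    rw [← hasSum_nat_add_iff' 1] at h1
    have h2 := (h1.mul_left (2 * σ)).sub (hsum.hasSum.mul_right (e * w x))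
    have hterm : (fun i => a i * (e * g i x - e * w x)) =
        fun i => 2 * σ * (α (i + 1) * u (i + 1) x) - a i * (e * w x) := by
      ext i
      change _ = 2 * σ * (e * a i / (2 * σ) * g i x) - _
      field_simp
    rw [hterm, h2.tsum_eq, Finset.sum_range_one]
    change 2 * σ * (y' x - -e / 2 * w x) - σ * (e * w x) = _
    ring
  obtain ⟨C, hC⟩ := hF.exists_norm_le
  have hbdd : BddAbove ((fun f => y' f) '' F) := by
    refine ⟨‖y'‖ * C, ?_⟩
    rintro _ ⟨x, hx, rfl⟩
    exact (le_abs_self _).trans ((y'.le_opNorm x).trans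
      (mul_le_mul_of_nonneg_left (hC x hx) (norm_nonneg _)))
  refine ⟨_, ⟨⟨f₀, hf₀⟩, rfl⟩, ?_⟩
  rintro _ ⟨x, rfl⟩
  simp only [hval]
  rw [hmax]
  exact mul_le_mul_of_nonneg_left (le_csSup hbdd ⟨x, x.2, rfl⟩) (by positivity)

theorem false_of_double_limit {E : Type*} [NormedAddCommGroup E] [NormedSpace ℝ E]
    {F : Set E} {A : Set (E →L[ℝ] ℝ)} (hF : IsBounded F) (hA : IsBounded A)
    (hattain : ∀ y' ∈ acoInf (wstarClosure A),
      ∃ f₀ ∈ F, y' f₀ = sSup ((fun f => y' f) '' F))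
    {f : ℕ → E} (hf : ∀ n, f n ∈ F) {g : ℕ → E →L[ℝ] ℝ} (hg : ∀ m, g m ∈ wstarClosure A)
    {g₀ : E →L[ℝ] ℝ} {c : ℕ → ℝ} {c₀ e ε : ℝ} (he : |e| = 1) (hε : 0 < ε)
    (hc : ∀ m, Tendsto (fun n => g m (f n)) atTop (𝓝 (c m)))
    (hg₀ : ∀ n, Tendsto (fun m => g m (f n)) atTop (𝓝 (g₀ (f n))))
    (hc₀ : Tendsto (fun n => g₀ (f n)) atTop (𝓝 c₀))
    (hsep : ∀ m, ε ≤ e * (c m - c₀)) : False := by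
  obtain ⟨R, hR0, hR⟩ := exists_bound_of_isBounded hA
  obtain ⟨C, hC⟩ := hF.exists_norm_le
  have hRC : ∀ k ∈ wstarClosure A, ∀ y ∈ F, |k y| ≤ R * C := fun k hk y hy =>
    (hR k hk y).trans (mul_le_mul_of_nonneg_left (hC y hy) hR0)
  refine false_of_attained (fun m (x : F) => e * g m x) (R * C) ε hε
    (fun i x => by rw [abs_mul, he, one_mul]; exact hRC _ (hg i) _ x.2) ?_
  intro s hs 𝒱 h𝒱
  obtain ⟨w, hw, hwlim⟩ := exists_tendsto_of_mem_wstarClosure hA 𝒱 (fun i => g (s i))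
    fun i => hg _
  have hwf : ∀ n, w (f n) = g₀ (f n) := fun n =>
    tendsto_nhds_unique (hwlim (f n)) (((hg₀ n).comp hs.tendsto_atTop).mono_left h𝒱)
  refine ⟨fun x => e * w x, fun x => (hwlim x).const_mul e, fun a ha hsum => ?_⟩
  obtain ⟨t, ht⟩ := exists_isGreatest_of_attained hF ⟨_, hf 0⟩ hR hR0 hattain
    (fun i => hg (s i)) hw he ha hsum
  refine ⟨t, ?_, ht⟩
  have hlim : Tendsto (fun n => ∑' i, a i * (e * g (s i) (f n) - e * w (f n))) atTop
      (𝓝 (∑' i, a i * (e * c (s i) - e * c₀))) := by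
    refine tendsto_tsum_of_dominated_convergence (bound := fun i => a i * (2 * (R * C)))
      (hsum.mul_right _) (fun i => ?_) (Eventually.of_forall fun n i => ?_)
    · simp only [hwf]
      exact (((hc (s i)).const_mul e).sub (hc₀.const_mul e)).const_mul _
    · rw [Real.norm_eq_abs, abs_mul, abs_of_nonneg (ha i), ← mul_sub, abs_mul, he, one_mul]
      refine mul_le_mul_of_nonneg_left ((abs_sub _ _).trans ?_) (ha i)
      have := hRC _ (hg (s i)) _ (hf n)
      have := hRC _ hw _ (hf n)
      linarith
  have hcb : ∀ m, |c m| ≤ R * C := fun m =>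
    le_of_tendsto (hc m).abs (Eventually.of_forall fun n => hRC _ (hg m) _ (hf n))
  have hsum' : Summable fun i => a i * (e * c (s i) - e * c₀) := by
    refine Summable.of_norm_bounded (hsum.mul_right (R * C + |c₀|)) fun i => ?_
    rw [Real.norm_eq_abs, abs_mul, abs_of_nonneg (ha i), ← mul_sub, abs_mul, he, one_mul]
    exact mul_le_mul_of_nonneg_left ((abs_sub _ _).trans (by gcongr; exact hcb _)) (ha i)
  calc ε * ∑' i, a i = ∑' i, a i * ε := by rw [tsum_mul_right, mul_comm]
    _ ≤ ∑' i, a i * (e * c (s i) - e * c₀) := by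
      refine (hsum.mul_right ε).tsum_le_tsum (fun i => ?_) hsum'
      rw [← mul_sub]
      exact mul_le_mul_of_nonneg_left (hsep _) (ha i)
    _ ≤ t := le_of_tendsto hlim (Eventually.of_forall fun n => ht.2 ⟨⟨f n, hf n⟩, rfl⟩)

theorem continuous_of_mem_pointwise_closure {E : Type*} [NormedAddCommGroup E]
    [NormedSpace ℝ E] {F : Set E} {A : Set (E →L[ℝ] ℝ)} (hF : IsBounded F) (hA : IsBounded A)
    (hattain : ∀ y' ∈ acoInf (wstarClosure A),
      ∃ f₀ ∈ F, y' f₀ = sSup ((fun f => y' f) '' F))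
    (φ : wstarClosure A → ℝ) (happ : ∀ (T : Finset (wstarClosure A)) (ε : ℝ), 0 < ε →
      ∃ f ∈ F, ∀ k ∈ T, |k.1 f - φ k| < ε) :
    @Continuous _ _ (subTop (wstarTop E) (wstarClosure A)) _ φ := by
  by_contra hφ
  obtain ⟨f, g, k₀, ε, hε, hf, hsep, hc, hg₀, hc₀⟩ :=
    exists_double_limit_sequences F (wstarClosure A) φ happ hφ
  have key : ∀ e : ℝ, |e| = 1 → ¬ ∃ᶠ m in atTop, ε ≤ e * (φ (g m) - φ k₀) := by
    intro e he hfr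
    obtain ⟨s, hs, hs'⟩ := extraction_of_frequently_atTop hfr
    exact false_of_double_limit hF hA hattain hf (fun m => (g (s m)).2) he hε
      (fun m => hc (s m)) (fun n => (hg₀ n).comp hs.tendsto_atTop) hc₀ hs'
  have h1 := key 1 (by simp)
  have h2 := key (-1) (by simp)
  rw [not_frequently] at h1 h2
  obtain ⟨m, hm1, hm2⟩ := (h1.and h2).exists
  rcases le_abs.1 (hsep m) with h | h
  · exact hm1 (by linarith)
  · exact hm2 (by linarith)

theorem exists_tendsto_ultrafilter_of_abs_le {ι : Type*} (𝒱 : Ultrafilter ι) {x : ι → ℝ}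
    {M : ℝ} (hx : ∀ i, |x i| ≤ M) : ∃ l, |l| ≤ M ∧ Tendsto x 𝒱 (𝓝 l) := by
  obtain ⟨l, hl, h⟩ := (isCompact_Icc (a := -M) (b := M)).ultrafilter_le_nhds (𝒱.map x)
    (tendsto_principal.2 (Eventually.of_forall fun i => abs_le.1 (hx i)))
  exact ⟨l, abs_le.2 hl, h⟩

theorem hyperfilter_nat_le_atTop : (hyperfilter ℕ : Filter ℕ) ≤ atTop :=
  hyperfilter_le_cofinite.trans_eq Nat.cofinite_eq_atTop

theorem exists_seq_forall_exists_subseq_tendsto {Z : Type*} [Nonempty Z] (u : ℕ → Z → ℝ) :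
    ∃ d : ℕ → Z, ∀ z, ∃ j : ℕ → ℕ, ∀ n, Tendsto (fun k => u n (d (j k))) atTop (𝓝 (u n z)) := by
  let e : Z → ℕ → ℝ := fun z n => u n z
  have hmem : ∀ j, ∃ z, e z = (TopologicalSpace.denseSeq (Set.range e) j).1 := fun j =>
    (TopologicalSpace.denseSeq (Set.range e) j).2
  choose d hd using hmem
  refine ⟨d, fun z => ?_⟩
  obtain ⟨x, hx, hlim⟩ := mem_closure_iff_seq_limit.1
    (TopologicalSpace.denseRange_denseSeq (Set.range e) ⟨e z, z, rfl⟩)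
  choose j hj using hx
  refine ⟨j, fun n => ?_⟩
  have h1 := tendsto_pi_nhds.1 ((continuous_subtype_val.tendsto _).comp hlim) n
  refine h1.congr fun k => ?_
  simp only [Function.comp, ← hj, ← hd]
  rfl

theorem exists_subseq_tendsto_of_continuous_cluster {Z : Type*} [TopologicalSpace Z]
    [CompactSpace Z] (u : ℕ → Z → ℝ) (M : ℝ) (hu : ∀ n z, |u n z| ≤ M)
    (hcont : ∀ φ ∈ closure (Set.range u), Continuous φ) :
    ∃ ψ : Z → ℝ, Continuous ψ ∧ ∃ s : ℕ → ℕ, StrictMono s ∧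
      ∀ z, Tendsto (fun n => u (s n) z) atTop (𝓝 (ψ z)) := by
  rcases isEmpty_or_nonempty Z with hZ | hZ
  · exact ⟨fun _ => 0, continuous_const, id, strictMono_id, fun z => isEmptyElim z⟩
  obtain ⟨d, hd⟩ := exists_seq_forall_exists_subseq_tendsto u
  have hucont : ∀ n, Continuous (u n) := fun n => hcont _ (subset_closure ⟨n, rfl⟩)
  obtain ⟨l, -, s, hs, hl⟩ :=
    (isCompact_univ_pi fun _ : ℕ => isCompact_Icc (a := -M) (b := M)).tendsto_subseq
      (x := fun n j => u n (d j)) fun n j _ => abs_le.1 (hu n (d j))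
  have hl' : ∀ j, Tendsto (fun n => u (s n) (d j)) atTop (𝓝 (l j)) := tendsto_pi_nhds.1 hl
  have hlim : ∀ (𝒱 : Ultrafilter ℕ), ∃ φ : Z → ℝ, Continuous φ ∧
      ∀ z, Tendsto (fun n => u (s n) z) 𝒱 (𝓝 (φ z)) := by
    intro 𝒱
    choose φ _ hφ using fun z => exists_tendsto_ultrafilter_of_abs_le 𝒱 fun n => hu (s n) z
    exact ⟨φ, hcont φ (mem_closure_of_tendsto (tendsto_pi_nhds.2 hφ)
      (Eventually.of_forall fun n => ⟨s n, rfl⟩)), hφ⟩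
  obtain ⟨ψ, hψc, hψ⟩ := hlim (hyperfilter ℕ)
  refine ⟨ψ, hψc, s, hs, fun z => (tendsto_iff_ultrafilter _ _ _).2 fun 𝒱 h𝒱 => ?_⟩
  obtain ⟨φ, hφc, hφ⟩ := hlim 𝒱
  obtain ⟨j, hj⟩ := hd z
  obtain ⟨z', -, hz'⟩ := isCompact_univ.ultrafilter_le_nhds
    ((hyperfilter ℕ).map fun k => d (j k)) (by simp)
  have hz'' : Tendsto (fun k => d (j k)) (hyperfilter ℕ) (𝓝 z') := hz'
  have hfib : ∀ n, u n z' = u n z := fun n => tendsto_nhds_unique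
    (((hucont n).tendsto z').comp hz'') ((hj n).mono_left hyperfilter_nat_le_atTop)
  have hφz : φ z' = φ z := tendsto_nhds_unique (hφ z') (by simpa only [hfib] using hφ z)
  have hψz : ψ z' = ψ z := tendsto_nhds_unique (hψ z') (by simpa only [hfib] using hψ z)
  have hφψ : ∀ i, φ (d i) = ψ (d i) := fun i =>
    (tendsto_nhds_unique (hφ (d i)) ((hl' i).mono_left h𝒱)).trans
      (tendsto_nhds_unique (hψ (d i)) ((hl' i).mono_left hyperfilter_nat_le_atTop)).symm
  have : φ z' = ψ z' := tendsto_nhds_unique ((hφc.tendsto z').comp hz'')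
    (((hψc.tendsto z').comp hz'').congr fun k => (hφψ _).symm)
  rw [← hψz, ← this, hφz]
  exact hφ z

theorem exists_tsum_near_limit {Z : Type*} [TopologicalSpace Z] [CompactSpace Z]
    {v : ℕ → Z → ℝ} {M : ℝ} {ψ : Z → ℝ} (hv : ∀ n z, |v n z| ≤ M) (hc : ∀ n, Continuous (v n))
    (hψ : Continuous ψ) (hlim : ∀ z, Tendsto (fun n => v n z) atTop (𝓝 (ψ z)))
    {ε : ℝ} (hε : 0 < ε) :
    ∃ s : ℕ → ℕ, StrictMono s ∧ ∃ a : ℕ → ℝ, (∀ i, 0 ≤ a i) ∧ HasSum a 1 ∧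
      ∀ z, |∑' i, a i * v (s i) z - ψ z| ≤ ε := by
  by_contra! hneg
  have hψM : ∀ z, |ψ z| ≤ M := fun z =>
    le_of_tendsto (hlim z).abs (Eventually.of_forall fun n => hv n z)
  have hG : ∀ n z, |v n z - ψ z| ≤ 2 * M := fun n z => by
    have := abs_sub (v n z) (ψ z)
    linarith [hv n z, hψM z]
  obtain ⟨z₀, -⟩ := hneg id strictMono_id (Pi.single 0 1)
    (Pi.single_nonneg.2 zero_le_one : (0 : ℕ → ℝ) ≤ Pi.single 0 1) (hasSum_pi_single 0 1)
  refine false_of_attained (fun n z => |v n z - ψ z|) (2 * M) ε hε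
    (fun n z => by rw [abs_abs]; exact hG n z) fun s hs 𝒱 h𝒱 => ⟨fun _ => 0, fun z => ?_, ?_⟩
  · have := (((hlim z).sub_const (ψ z)).abs.comp hs.tendsto_atTop).mono_left h𝒱
    simpa [Function.comp_def] using this
  intro a ha hsum
  simp only [sub_zero]
  have hbd : ∀ i z, ‖a i * |v (s i) z - ψ z|‖ ≤ a i * (2 * M) := fun i z => by
    rw [Real.norm_eq_abs, abs_mul, abs_abs, abs_of_nonneg (ha i)]
    exact mul_le_mul_of_nonneg_left (hG _ _) (ha i)
  have hcont : Continuous fun z => ∑' i, a i * |v (s i) z - ψ z| :=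
    continuous_tsum (fun i => continuous_const.mul ((hc _).sub hψ).abs)
      (hsum.mul_right (2 * M)) hbd
  obtain ⟨z₁, -, hz₁⟩ := isCompact_univ.exists_isMaxOn ⟨z₀, Set.mem_univ _⟩ hcont.continuousOn
  refine ⟨_, ?_, ⟨z₁, rfl⟩, ?_⟩
  swap
  · rintro _ ⟨z, rfl⟩
    exact hz₁ (Set.mem_univ z)
  obtain hσ | hσ := (tsum_nonneg ha).eq_or_lt
  · rw [← hσ, mul_zero]
    exact tsum_nonneg fun i => mul_nonneg (ha i) (abs_nonneg _)
  set σ := ∑' i, a i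
  have hone : HasSum (fun i => a i / σ) 1 := by
    rw [← div_self hσ.ne']
    exact hsum.hasSum.div_const σ
  obtain ⟨z, hz⟩ := hneg s hs (fun i => a i / σ) (fun i => div_nonneg (ha i) hσ.le) hone
  have hsv : Summable fun i => a i / σ * v (s i) z := by
    refine Summable.of_norm_bounded (hone.summable.mul_right M) fun i => ?_
    rw [Real.norm_eq_abs, abs_mul, abs_of_nonneg (div_nonneg (ha i) hσ.le)]
    exact mul_le_mul_of_nonneg_left (hv _ _) (div_nonneg (ha i) hσ.le)
  have heq : ∑' i, a i / σ * v (s i) z - ψ z = (∑' i, a i * (v (s i) z - ψ z)) / σ := by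
    have h1 := (hsv.hasSum.sub (hone.mul_right (ψ z)))
    rw [one_mul] at h1
    rw [← h1.tsum_eq, ← tsum_div_const]
    exact tsum_congr fun i => by ring
  have habs : |∑' i, a i * (v (s i) z - ψ z)| ≤ ∑' i, a i * |v (s i) z - ψ z| := by
    have := norm_tsum_le_tsum_norm (f := fun i => a i * (v (s i) z - ψ z))
      (Summable.of_nonneg_of_le (fun i => norm_nonneg _) (fun i => by
        rw [Real.norm_eq_abs, abs_mul, abs_of_nonneg (ha i)]
        exact mul_le_mul_of_nonneg_left (hG _ _) (ha i)) (hsum.mul_right (2 * M)))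
    simpa only [Real.norm_eq_abs, abs_mul, abs_of_nonneg (ha _)] using this
  rw [heq, abs_div, abs_of_pos hσ, lt_div_iff₀ hσ] at hz
  exact hz.le.trans (habs.trans (hz₁ (Set.mem_univ z)))

theorem compactSpace_wstarClosure {E : Type*} [NormedAddCommGroup E] [NormedSpace ℝ E]
    {A : Set (E →L[ℝ] ℝ)} (hA : IsBounded A) :
    @CompactSpace (wstarClosure A) (subTop (wstarTop E) (wstarClosure A)) := by
  let _ := subTop (wstarTop E) (wstarClosure A)
  refine ⟨isCompact_iff_ultrafilter_le_nhds.2 fun 𝒱 _ => ?_⟩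
  obtain ⟨w, hw, h⟩ := exists_tendsto_of_mem_wstarClosure hA 𝒱
    (fun k : wstarClosure A => k.1) fun k => k.2
  exact ⟨⟨w, hw⟩, Set.mem_univ _, nhds_subTop_wstarTop.2 h⟩

theorem continuous_eval_subTop {E : Type*} [NormedAddCommGroup E] [NormedSpace ℝ E]
    (Z : Set (E →L[ℝ] ℝ)) (y : E) :
    @Continuous _ _ (subTop (wstarTop E) Z) _ fun k : Z => k.1 y :=
  continuous_subTop_iff.2 fun _ _ h => h y

theorem exists_near_of_mem_closure_pi {Z : Type*} {S : Set (Z → ℝ)} {φ : Z → ℝ}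
    (hφ : φ ∈ closure S) (T : Finset Z) {ε : ℝ} (hε : 0 < ε) :
    ∃ f ∈ S, ∀ k ∈ T, |f k - φ k| < ε := by
  have hev : ∀ᶠ f in 𝓝 φ, ∀ k ∈ T, |f k - φ k| < ε := by
    refine (Filter.eventually_all_finset T).2 fun k _ => ?_
    filter_upwards [((continuous_apply k).tendsto φ).eventually (Metric.ball_mem_nhds _ hε)]
      with f hf
    simpa [Real.dist_eq] using hf
  obtain ⟨f, hf, hfS⟩ := mem_closure_iff_nhds.1 hφ _ hev
  exact ⟨f, hfS, hf⟩

theorem exists_convex_series_near_limit {E : Type*} [NormedAddCommGroup E] [NormedSpace ℝ E]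
    [CompleteSpace E] {A : Set (E →L[ℝ] ℝ)} (hA : IsBounded A) {v : ℕ → E} {C : ℝ}
    (hv : ∀ n, ‖v n‖ ≤ C) {ψ : wstarClosure A → ℝ}
    (hψ : @Continuous _ _ (subTop (wstarTop E) (wstarClosure A)) _ ψ)
    (hlim : ∀ b, Tendsto (fun n => b.1 (v n)) atTop (𝓝 (ψ b))) {ε : ℝ} (hε : 0 < ε) :
    ∃ y : E, (∀ b, |b.1 y - ψ b| ≤ ε) ∧ ∀ (k : E →L[ℝ] ℝ) (l : ℝ),
      (∀ n, k (v n) ≤ l) → k y ≤ l := by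
  let _ := subTop (wstarTop E) (wstarClosure A)
  have := compactSpace_wstarClosure hA
  obtain ⟨R, hR0, hR⟩ := exists_bound_of_isBounded hA
  obtain ⟨s, -, a, ha, hsum, hnear⟩ := exists_tsum_near_limit
    (v := fun n (b : wstarClosure A) => b.1 (v n)) (M := R * C)
    (fun n b => (hR _ b.2 _).trans (mul_le_mul_of_nonneg_left (hv n) hR0))
    (fun n => continuous_eval_subTop _ (v n)) hψ hlim hε
  have hy : Summable fun i => a i • v (s i) := by
    refine Summable.of_norm_bounded (hsum.summable.mul_right C) fun i => ?_
    rw [norm_smul, Real.norm_eq_abs, abs_of_nonneg (ha i)]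
    exact mul_le_mul_of_nonneg_left (hv _) (ha i)
  have happly : ∀ k : E →L[ℝ] ℝ,
      HasSum (fun i => a i * k (v (s i))) (k (∑' i, a i • v (s i))) := fun k => by
    simpa using hy.hasSum.mapL k
  refine ⟨∑' i, a i • v (s i), fun b => ?_, fun k l hl => ?_⟩
  · rw [← (happly b.1).tsum_eq]
    exact hnear b
  · have := hasSum_le (fun i => mul_le_mul_of_nonneg_left (hl (s i)) (ha i)) (happly k)
      (hsum.mul_right l)
    rwa [one_mul] at this

theorem exists_continuous_limit_on_aco {E : Type*} [NormedAddCommGroup E] [NormedSpace ℝ E]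
    [CompleteSpace E] {A : Set (E →L[ℝ] ℝ)} (hA : IsBounded A) {v : ℕ → E} {C : ℝ}
    (hv : ∀ n, ‖v n‖ ≤ C) {ψ : wstarClosure A → ℝ}
    (hψ : @Continuous _ _ (subTop (wstarTop E) (wstarClosure A)) _ ψ)
    (hlim : ∀ b, Tendsto (fun n => b.1 (v n)) atTop (𝓝 (ψ b))) :
    ∃ Ψ : wstarClosure (aco A) → ℝ,
      @Continuous _ _ (subTop (wstarTop E) (wstarClosure (aco A))) _ Ψ ∧
      ∀ k, Tendsto (fun n => k.1 (v n)) atTop (𝓝 (Ψ k)) := by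
  have hmix : ∀ {ε : ℝ}, 0 < ε → ∀ s : ℕ → ℕ, StrictMono s →
      ∃ y : E, (∀ b, |b.1 y - ψ b| ≤ ε) ∧ ∀ (k : E →L[ℝ] ℝ) (l : ℝ),
        (∀ n, k (v (s n)) ≤ l) → k y ≤ l := fun hε s hs =>
    exists_convex_series_near_limit hA (fun n => hv (s n)) hψ
      (fun b => (hlim b).comp hs.tendsto_atTop) hε
  have hclose : ∀ {ε : ℝ} {y y' : E}, (∀ b, |b.1 y - ψ b| ≤ ε) → (∀ b, |b.1 y' - ψ b| ≤ ε) →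
      ∀ k ∈ wstarClosure (aco A), |k y - k y'| ≤ 2 * ε := by
    intro ε y y' hy hy' k hk
    rw [← map_sub]
    refine abs_apply_le_of_mem_wstarClosure
      (fun a ha => abs_apply_le_of_mem_aco (fun b hb => ?_) ha) hk
    rw [map_sub]
    have h1 := hy ⟨b, subset_wstarClosure A hb⟩
    have h2 := hy' ⟨b, subset_wstarClosure A hb⟩
    rw [abs_le] at h1 h2 ⊢
    constructor <;> linarith [h1.1, h1.2, h2.1, h2.2]
  have hex : ∀ k : wstarClosure (aco A), ∃ l, Tendsto (fun n => k.1 (v n)) atTop (𝓝 l) := by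
    intro k
    have hb : ∀ n, |k.1 (v n)| ≤ ‖k.1‖ * C := fun n =>
      (k.1.le_opNorm _).trans (mul_le_mul_of_nonneg_left (hv n) (norm_nonneg _))
    refine tendsto_of_no_upcrossings dense_univ (fun a _ b _ hab ⟨h1, h2⟩ => ?_)
      (isBoundedUnder_of ⟨_, fun n => (abs_le.1 (hb n)).2⟩)
      (isBoundedUnder_of ⟨_, fun n => (abs_le.1 (hb n)).1⟩)
    obtain ⟨s, hs, hs'⟩ := extraction_of_frequently_atTop h1
    obtain ⟨r, hr, hr'⟩ := extraction_of_frequently_atTop h2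
    have hε : 0 < (b - a) / 3 := by linarith
    obtain ⟨y, hy, hyl⟩ := hmix hε s hs
    obtain ⟨y', hy', hyl'⟩ := hmix hε r hr
    have h1 := hyl k.1 a fun n => (hs' n).le
    have h2 := hyl' (-k.1) (-b) fun n => neg_le_neg (hr' n).le
    have h3 := (abs_le.1 (hclose hy hy' k.1 k.2)).1
    rw [neg_apply] at h2
    linarith
  choose Ψ hΨ using hex
  refine ⟨Ψ, continuous_subTop_iff.2 fun k₀ 𝒱 h𝒱 => Metric.tendsto_nhds.2 fun δ hδ => ?_, hΨ⟩
  obtain ⟨ε, hε, hεδ⟩ : ∃ ε : ℝ, 0 < ε ∧ 7 * ε = δ := ⟨δ / 7, by positivity, by ring⟩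
  obtain ⟨y, hy, -⟩ := hmix hε id strictMono_id
  have hunif : ∀ k, |Ψ k - k.1 y| ≤ 3 * ε := by
    intro k
    obtain ⟨N, hN⟩ := eventually_atTop.1 ((hΨ k).eventually (Metric.closedBall_mem_nhds _ hε))
    obtain ⟨y', hy', hyl⟩ := hmix hε (fun n => n + N) (strictMono_id.add_const N)
    have hN' : ∀ n, |k.1 (v (n + N)) - Ψ k| ≤ ε := fun n => by
      simpa [Real.dist_eq] using hN (n + N) (Nat.le_add_left _ _)
    have h1 := hyl k.1 (Ψ k + ε) fun n => by linarith [(abs_le.1 (hN' n)).2]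
    have h2 := hyl (-k.1) (-(Ψ k - ε)) fun n => by
      rw [neg_apply]
      linarith [(abs_le.1 (hN' n)).1]
    rw [neg_apply] at h2
    have h3 := abs_le.1 (hclose hy hy' k.1 k.2)
    exact abs_le.2 ⟨by linarith [h3.1, h3.2], by linarith [h3.1, h3.2]⟩
  filter_upwards [(h𝒱 y).eventually (Metric.ball_mem_nhds _ hε)] with k hk
  rw [Real.dist_eq] at hk
  rw [Real.dist_eq]
  have h1 := abs_le.1 (hunif k)
  have h2 := abs_le.1 (hunif k₀)
  have h3 := abs_lt.1 hk
  exact abs_lt.2 ⟨by linarith [h1.1, h2.2, h3.1], by linarith [h1.2, h2.1, h3.2]⟩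

theorem exists_subseq_tendsto_on_aco {E : Type*} [NormedAddCommGroup E] [NormedSpace ℝ E]
    [CompleteSpace E] {F : Set E} {A : Set (E →L[ℝ] ℝ)} (hF : IsBounded F) (hA : IsBounded A)
    (hattain : ∀ y' ∈ acoInf (wstarClosure A),
      ∃ f₀ ∈ F, y' f₀ = sSup ((fun f => y' f) '' F))
    (u : ℕ → E) (hu : ∀ n, u n ∈ F) :
    ∃ Ψ : wstarClosure (aco A) → ℝ,
      @Continuous _ _ (subTop (wstarTop E) (wstarClosure (aco A))) _ Ψ ∧
      ∃ s : ℕ → ℕ, StrictMono s ∧ ∀ k, Tendsto (fun n => k.1 (u (s n))) atTop (𝓝 (Ψ k)) := by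
  let _ := subTop (wstarTop E) (wstarClosure A)
  have := compactSpace_wstarClosure hA
  obtain ⟨R, hR0, hR⟩ := exists_bound_of_isBounded hA
  obtain ⟨C, hC⟩ := hF.exists_norm_le
  obtain ⟨ψ, hψ, s, hs, hlim⟩ := exists_subseq_tendsto_of_continuous_cluster
    (fun n (b : wstarClosure A) => b.1 (u n)) (R * C)
    (fun n b => (hR _ b.2 _).trans (mul_le_mul_of_nonneg_left (hC _ (hu n)) hR0))
    fun φ hφ => continuous_of_mem_pointwise_closure hF hA hattain φ fun T ε hε => by
      obtain ⟨_, ⟨n, rfl⟩, hn⟩ := exists_near_of_mem_closure_pi hφ T hε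
      exact ⟨u n, hu n, hn⟩
  obtain ⟨Ψ, hΨ, hΨlim⟩ := exists_continuous_limit_on_aco hA (fun n => hC _ (hu (s n))) hψ hlim
  exact ⟨Ψ, hΨ, s, hs, hΨlim⟩

theorem continuous_of_mem_pointwise_closure_on_aco {E : Type*} [NormedAddCommGroup E]
    [NormedSpace ℝ E] [CompleteSpace E] {F : Set E} {A : Set (E →L[ℝ] ℝ)}
    (hF : IsBounded F) (hA : IsBounded A)
    (hattain : ∀ y' ∈ acoInf (wstarClosure A),
      ∃ f₀ ∈ F, y' f₀ = sSup ((fun f => y' f) '' F))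
    (φ : wstarClosure (aco A) → ℝ) (happ : ∀ (T : Finset (wstarClosure (aco A))) (ε : ℝ), 0 < ε →
      ∃ f ∈ F, ∀ k ∈ T, |k.1 f - φ k| < ε) :
    @Continuous _ _ (subTop (wstarTop E) (wstarClosure (aco A))) _ φ := by
  by_contra hφ
  obtain ⟨f, g, k₀, ε, hε, hf, hsep, hc, hg₀, hc₀⟩ :=
    exists_double_limit_sequences F (wstarClosure (aco A)) φ happ hφ
  obtain ⟨Ψ, hΨ, s, hs, hlim⟩ := exists_subseq_tendsto_on_aco hF hA hattain f hf
  have hΨg : ∀ m, Ψ (g m) = φ (g m) := fun m =>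
    tendsto_nhds_unique (hlim (g m)) ((hc m).comp hs.tendsto_atTop)
  have hΨ₀ : Ψ k₀ = φ k₀ := tendsto_nhds_unique (hlim k₀) (hc₀.comp hs.tendsto_atTop)
  obtain ⟨w, hw, hwlim⟩ := exists_tendsto_of_mem_wstarClosure (isBounded_aco hA)
    (hyperfilter ℕ) (fun m => (g m).1) fun m => (g m).2
  have hwf : ∀ n, w (f n) = k₀.1 (f n) := fun n =>
    tendsto_nhds_unique (hwlim (f n)) ((hg₀ n).mono_left hyperfilter_nat_le_atTop)
  have hΨw : Ψ ⟨w, hw⟩ = Ψ k₀ :=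
    tendsto_nhds_unique (hlim ⟨w, hw⟩) (by simpa only [hwf] using hlim k₀)
  have hconv : Tendsto (fun m => Ψ (g m)) (hyperfilter ℕ) (𝓝 (Ψ ⟨w, hw⟩)) :=
    continuous_subTop_iff.1 hΨ ⟨w, hw⟩ ((hyperfilter ℕ).map g) hwlim
  have hle : ε ≤ |Ψ ⟨w, hw⟩ - Ψ k₀| := ge_of_tendsto (hconv.sub_const (Ψ k₀)).abs
    (Eventually.of_forall fun m => by rw [hΨg, hΨ₀]; exact hsep m)
  rw [hΨw, sub_self, abs_zero] at hle
  exact hle.not_gt hε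

theorem isInducing_val_CK {E : Type*} [NormedAddCommGroup E] [NormedSpace ℝ E]
    (K : Set (E →L[ℝ] ℝ)) : IsInducing fun h : CK K => h.1 :=
  ⟨rfl⟩

/-- "James2.1": if every `y* ∈ aco_∞(cl_w*(A))` attains its supremum
on `F`, then `F|_{cl_w*(aco A)}` is relatively compact and relatively sequentially
compact in `(C(cl_w*(aco A)), τ_p)`. -/
theorem stmt5 [CompleteSpace Y]
    (F : Set Y) (A : Set (Y →L[ℝ] ℝ))
    (hF : IsBounded F) (hA : IsBounded A)
    (hattain : ∀ y' ∈ acoInf (wstarClosure A),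
      ∃ f₀ ∈ F, y' f₀ = sSup ((fun f => y' f) '' F)) :
    -- relative compactness of `F|_{cl_w*(aco A)}`:
    IsCompact (closure (resSet F (wstarClosure (aco A)))) ∧
    -- relative sequential compactness of `F|_{cl_w*(aco A)}`:
    (∀ u : ℕ → CK (wstarClosure (aco A)), (∀ n, u n ∈ resSet F (wstarClosure (aco A))) →
      ∃ (h : CK (wstarClosure (aco A))) (φ : ℕ → ℕ), StrictMono φ ∧
        Tendsto (u ∘ φ) atTop (𝓝 h)) := by
  have hind := isInducing_val_CK (wstarClosure (aco A))
  constructor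
  · obtain ⟨R, hR0, hR⟩ := exists_bound_of_isBounded (isBounded_aco hA)
    obtain ⟨C, hC⟩ := hF.exists_norm_le
    rw [hind.closure_eq_preimage_closure_image]
    refine hind.isCompact_preimage' ?_ fun φ hφ => ?_
    · refine (isCompact_univ_pi fun _ => isCompact_Icc (a := -(R * C)) (b := R * C)).of_isClosed_subset
        isClosed_closure (closure_minimal ?_ (isClosed_set_pi fun _ _ => isClosed_Icc))
      rintro _ ⟨h, ⟨f, hf, hfh⟩, rfl⟩ k -
      change h.1 k ∈ _
      rw [hfh]
      exact abs_le.1 ((hR _ k.2 _).trans (mul_le_mul_of_nonneg_left (hC f hf) hR0))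
    · refine ⟨⟨φ, continuous_of_mem_pointwise_closure_on_aco hF hA hattain φ fun T ε hε => ?_⟩, rfl⟩
      obtain ⟨_, ⟨h, ⟨f, hf, hfh⟩, rfl⟩, hn⟩ := exists_near_of_mem_closure_pi hφ T hε
      exact ⟨f, hf, fun k hk => hfh k ▸ hn k hk⟩
  · intro u hu
    choose f hf hfu using hu
    obtain ⟨Ψ, hΨ, s, hs, hlim⟩ := exists_subseq_tendsto_on_aco hF hA hattain f hf
    refine ⟨⟨Ψ, hΨ⟩, s, hs, hind.tendsto_nhds_iff.2 (tendsto_pi_nhds.2 fun k => ?_)⟩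
    exact (hlim k).congr fun n => (hfu (s n) k).symm
end
end

section
/- Let Y be a real Banach space and N ⊆ B(Y*) a norming set for Y. A weakly closed bounded subset F of Y is weakly compact if and only if every functional y* ∈ aco_∞(cl_{w*}(N)) ⊆ Y* attains its supremum on F. -/
open Filter Topology Metric Bornology

noncomputable section

variable {X : Type*} [NormedAddCommGroup X] [NormedSpace ℝ X]

/-! ### Infinite convex combinations of a sequence of functions -/

/-- The infinite convex combinations of the functions `v n` with `N ≤ n`. -/
def tailCombos {Z : Type*} (v : ℕ → Z → ℝ) (N : ℕ) : Set (Z → ℝ) :=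
  {u | ∃ lam : ℕ → ℝ, (∀ n, 0 ≤ lam n) ∧ (∀ n < N, lam n = 0) ∧ HasSum lam 1 ∧
    ∀ x, HasSum (fun n => lam n * v n x) (u x)}

section TailCombos

variable {Z : Type*} {v : ℕ → Z → ℝ} {N : ℕ} {u : Z → ℝ} {K : ℝ}

lemma tailCombos_antitone {M : ℕ} (h : M ≤ N) : tailCombos v N ⊆ tailCombos v M := by
  rintro u ⟨lam, h0, h1, h2, h3⟩
  exact ⟨lam, h0, fun n hn => h1 n (hn.trans_le h), h2, h3⟩

lemma self_mem_tailCombos : v N ∈ tailCombos v N := by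
  refine ⟨fun n => if n = N then 1 else 0, fun n => by dsimp only; split_ifs <;> simp,
    fun n hn => by simp [hn.ne], hasSum_ite_eq N 1, fun x => ?_⟩
  convert hasSum_ite_eq N (v N x) using 2 with n
  split_ifs with h <;> simp [h]

lemma le_of_mem_tailCombos (hu : u ∈ tailCombos v N) {x : Z} {B : ℝ}
    (h : ∀ n ≥ N, v n x ≤ B) : u x ≤ B := by
  obtain ⟨lam, h0, h1, h2, h3⟩ := hu
  have := h2.mul_right B
  rw [one_mul] at this
  refine hasSum_le (fun n => ?_) (h3 x) this
  rcases lt_or_ge n N with hn | hn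
  · simp [h1 n hn]
  · exact mul_le_mul_of_nonneg_left (h n hn) (h0 n)

lemma le_of_mem_tailCombos' (hu : u ∈ tailCombos v N) {x : Z} {B : ℝ}
    (h : ∀ n ≥ N, B ≤ v n x) : B ≤ u x := by
  obtain ⟨lam, h0, h1, h2, h3⟩ := hu
  have := h2.mul_right B
  rw [one_mul] at this
  refine hasSum_le (fun n => ?_) this (h3 x)
  rcases lt_or_ge n N with hn | hn
  · simp [h1 n hn]
  · exact mul_le_mul_of_nonneg_left (h n hn) (h0 n)

lemma exists_lt_of_mem_tailCombos (hu : u ∈ tailCombos v N) {x : Z} {B : ℝ} (h : B < u x) :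
    ∃ n ≥ N, B < v n x := by
  by_contra! hc
  exact absurd (le_of_mem_tailCombos hu hc) (not_le.2 h)

lemma abs_le_of_mem_tailCombos (hv : ∀ n x, |v n x| ≤ K) (hu : u ∈ tailCombos v N) (x : Z) :
    |u x| ≤ K :=
  abs_le.2 ⟨le_of_mem_tailCombos' hu fun n _ => (abs_le.1 (hv n x)).1,
    le_of_mem_tailCombos hu fun n _ => (abs_le.1 (hv n x)).2⟩

lemma hasSum_half_pow_succ : HasSum (fun k : ℕ => (1 / 2 : ℝ) ^ (k + 1)) 1 := by
  have := hasSum_geometric_two.mul_left (1 / 2 : ℝ)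
  norm_num at this
  simpa [pow_succ, mul_comm] using this

lemma summable_half_pow_mul {t : ℕ → ℝ} (ht : ∀ k, |t k| ≤ K) :
    Summable (fun k => (1 / 2 : ℝ) ^ (k + 1) * t k) := by
  refine Summable.of_norm_bounded (hasSum_half_pow_succ.summable.mul_right K) fun k => ?_
  rw [norm_mul, Real.norm_of_nonneg (by positivity)]
  exact mul_le_mul_of_nonneg_left (ht k) (by positivity)

lemma tsum_half_pow_mul_mem_tailCombos (hv : ∀ n x, |v n x| ≤ K) {g : ℕ → Z → ℝ}
    (hg : ∀ k, g k ∈ tailCombos v N) :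
    (fun x => ∑' k, (1 / 2 : ℝ) ^ (k + 1) * g k x) ∈ tailCombos v N := by
  choose lam h0 h1 h2 h3 using hg
  have hsum : Summable (fun p : ℕ × ℕ => (1 / 2 : ℝ) ^ (p.1 + 1) * lam p.1 p.2) := by
    have hnn : (0 : ℕ × ℕ → ℝ) ≤ fun p => (1 / 2 : ℝ) ^ (p.1 + 1) * lam p.1 p.2 :=
      fun p => by
        have := h0 p.1 p.2
        rw [Pi.zero_apply]
        positivity
    refine (summable_prod_of_nonneg hnn).2 ⟨fun k => (h2 k).summable.mul_left ((1 / 2 : ℝ) ^ (k + 1)), ?_⟩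
    simp only [tsum_mul_left, (h2 _).tsum_eq, mul_one]
    exact hasSum_half_pow_succ.summable
  have key : ∀ (c : ℕ → ℝ) (C : ℝ), (∀ n, |c n| ≤ C) →
      HasSum (fun n => (∑' k, (1 / 2 : ℝ) ^ (k + 1) * lam k n) * c n)
        (∑' k, (1 / 2 : ℝ) ^ (k + 1) * ∑' n, lam k n * c n) := by
    intro c C hc
    have hs : Summable (fun p : ℕ × ℕ => (1 / 2 : ℝ) ^ (p.1 + 1) * (lam p.1 p.2 * c p.2)) := by
      refine Summable.of_norm_bounded (hsum.mul_right C) fun p => ?_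
      have hp : 0 ≤ (1 / 2 : ℝ) ^ (p.1 + 1) * lam p.1 p.2 := mul_nonneg (by positivity) (h0 _ _)
      rw [← mul_assoc, norm_mul, Real.norm_of_nonneg hp]
      exact mul_le_mul_of_nonneg_left (hc _) hp
    have hs' := (Equiv.prodComm ℕ ℕ).summable_iff.2 hs
    have h := hs'.hasSum.prod_fiberwise (fun n => (hs'.prod_factor n).hasSum)
    convert h using 1
    · ext n
      rw [← tsum_mul_right]
      exact tsum_congr fun k => by simp [mul_assoc]
    · refine Eq.trans ?_ ((Equiv.prodComm ℕ ℕ).tsum_eq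
        (fun p : ℕ × ℕ => (1 / 2 : ℝ) ^ (p.1 + 1) * (lam p.1 p.2 * c p.2))).symm
      rw [hs.tsum_prod]
      exact tsum_congr fun k => by simp only [tsum_mul_left]
  refine ⟨fun n => ∑' k, (1 / 2 : ℝ) ^ (k + 1) * lam k n,
    fun n => tsum_nonneg fun k => mul_nonneg (by positivity) (h0 _ _),
    fun n hn => by simp [h1 _ n hn], ?_, fun x => ?_⟩
  · have h := key (fun _ => 1) 1 (by simp)
    simpa only [mul_one, (h2 _).tsum_eq, hasSum_half_pow_succ.tsum_eq] using h
  · have h := key (fun n => v n x) K (fun n => hv n x)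
    simpa only [(h3 _ x).tsum_eq] using h

/-- A version of the Simons lemma: some infinite convex combination `u` has the property that the
`v n` are frequently almost as large as `A` at every maximiser of `u`. -/
lemma exists_tailCombo_frequently_lt [Nonempty Z] (hv : ∀ n x, |v n x| ≤ K) {A ε : ℝ} (hε : 0 < ε)
    (hA : ∀ u ∈ tailCombos v 0, ∀ B < A, ∃ x, B < u x) :
    ∃ u ∈ tailCombos v 0, ∀ z, (∀ z', u z' ≤ u z) → ∀ N, ∃ n ≥ N, A - ε < v n z := by
  have hbdd : ∀ {h : Z → ℝ} {C : ℝ} (_ : ∀ x, |h x| ≤ C) (b : ℝ) {n : ℕ} {g : Z → ℝ}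
      (_ : g ∈ tailCombos v n) (x : Z), |h x + b * g x| ≤ C + |b| * K := by
    intro h C hC b n g hg x
    refine (abs_add_le _ _).trans (add_le_add (hC x) ?_)
    rw [abs_mul]
    exact mul_le_mul_of_nonneg_left (abs_le_of_mem_tailCombos hv hg x) (abs_nonneg _)
  have step : ∀ (h : Z → ℝ) (n : ℕ), ∃ g ∈ tailCombos v n, (∃ C, ∀ x, |h x| ≤ C) →
      ∀ g' ∈ tailCombos v n, (⨆ x, (h x + (1 / 2) ^ n * g x)) ≤
        (⨆ x, (h x + (1 / 2) ^ n * g' x)) + (1 / 2) ^ n * (ε * (1 / 2) ^ (n + 2)) := by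
    intro h n
    by_cases hC : ∃ C, ∀ x, |h x| ≤ C
    · obtain ⟨C, hC⟩ := hC
      set S := (fun g : Z → ℝ => ⨆ x, (h x + (1 / 2) ^ n * g x)) '' tailCombos v n with hS
      have hne : S.Nonempty := ⟨_, _, self_mem_tailCombos, rfl⟩
      have hbb : BddBelow S := by
        refine ⟨-(C + |(1 / 2 : ℝ) ^ n| * K), ?_⟩
        rintro _ ⟨g, hg, rfl⟩
        obtain ⟨x⟩ := ‹Nonempty Z›
        refine (abs_le.1 (hbdd hC ((1 / 2) ^ n) hg x)).1.trans
          (le_ciSup (f := fun x => h x + (1 / 2) ^ n * g x) ?_ x)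
        exact ⟨_, by rintro _ ⟨y, rfl⟩; exact (abs_le.1 (hbdd hC ((1 / 2) ^ n) hg y)).2⟩
      obtain ⟨_, ⟨g, hg, rfl⟩, hlt⟩ := exists_lt_of_csInf_lt hne
        (lt_add_of_pos_right (sInf S)
          (show 0 < (1 / 2 : ℝ) ^ n * (ε * (1 / 2) ^ (n + 2)) by positivity))
      exact ⟨g, hg, fun _ g' hg' => hlt.le.trans
        (add_le_add_left (csInf_le hbb ⟨g', hg', rfl⟩) _)⟩
    · exact ⟨v n, self_mem_tailCombos, fun h => absurd h hC⟩
  choose G hG hGmin using step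
  let h : ℕ → Z → ℝ := fun n =>
    Nat.rec 0 (fun n h x => h x + (1 / 2) ^ (n + 1) * G h n x) n
  let g : ℕ → Z → ℝ := fun n => G (h n) n
  have hsucc : ∀ n x, h (n + 1) x = h n x + (1 / 2) ^ (n + 1) * g n x := fun n x => rfl
  have hg : ∀ n, g n ∈ tailCombos v n := fun n => hG _ _
  have hgK : ∀ n x, |g n x| ≤ K := fun n x => abs_le_of_mem_tailCombos hv (hg n) x
  have hhbdd : ∀ n, ∃ C, ∀ x, |h n x| ≤ C := by
    intro n
    induction n with
    | zero => exact ⟨0, fun x => by simp [h]⟩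
    | succ n ih =>
      obtain ⟨C, hC⟩ := ih
      exact ⟨_, fun x => hbdd hC _ (hg n) x⟩
  let τ : ℕ → Z → ℝ := fun n x => ∑' k, (1 / 2 : ℝ) ^ (k + 1) * g (n + k) x
  have hτ : ∀ n, τ n ∈ tailCombos v n := fun n =>
    tsum_half_pow_mul_mem_tailCombos hv fun k => tailCombos_antitone (Nat.le_add_right n k) (hg _)
  have hτsucc : ∀ n x, τ n x = (g n x + τ (n + 1) x) / 2 := by
    intro n x
    have hs := summable_half_pow_mul (fun k => hgK (n + k) x)
    simp only [τ]
    rw [hs.tsum_eq_zero_add, add_div, ← tsum_div_const]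
    congr 1
    · simp; ring
    · refine tsum_congr fun k => ?_
      rw [show n + (k + 1) = n + 1 + k by ring]; ring
  have hu : ∀ n x, τ 0 x = h n x + (1 / 2) ^ n * τ n x := by
    intro n x
    induction n with
    | zero => simp [h]
    | succ n ih => rw [ih, hsucc, hτsucc n x]; ring
  refine ⟨τ 0, hτ 0, fun z hz N => ?_⟩
  have hstep : ∀ n, g n z ≤ τ n z + ε * (1 / 2) ^ (n + 2) := by
    intro n
    obtain ⟨C, hC⟩ := hhbdd n
    have h1 : h n z + (1 / 2) ^ n * g n z ≤ ⨆ x, (h n x + (1 / 2) ^ n * g n x) :=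
      le_ciSup (f := fun x => h n x + (1 / 2) ^ n * g n x)
        ⟨_, by rintro _ ⟨y, rfl⟩; exact (abs_le.1 (hbdd hC ((1 / 2) ^ n) (hg n) y)).2⟩ z
    have h2 := hGmin (h n) n ⟨C, hC⟩ (τ n) (hτ n)
    have h3 : (⨆ x, (h n x + (1 / 2) ^ n * τ n x)) ≤ h n z + (1 / 2) ^ n * τ n z :=
      ciSup_le fun x => by rw [← hu, ← hu]; exact hz x
    have h4 : (1 / 2 : ℝ) ^ n * g n z ≤ (1 / 2) ^ n * (τ n z + ε * (1 / 2) ^ (n + 2)) := by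
      change (⨆ x, (h n x + (1 / 2) ^ n * g n x)) ≤ _ at h2
      linarith
    exact le_of_mul_le_mul_left h4 (by positivity)
  have hlow : ∀ n, A - ε / 2 + ε * (1 / 2) ^ (n + 1) ≤ τ n z := by
    intro n
    induction n with
    | zero =>
      have : A ≤ τ 0 z := le_of_forall_lt fun B hB => by
        obtain ⟨x, hx⟩ := hA _ (hτ 0) B hB
        exact hx.trans_le (hz x)
      linarith
    | succ n ih =>
      have h1 := hstep n
      have h2 := hτsucc n z
      have h3 : ε * (1 / 2 : ℝ) ^ (n + 1) = 2 * (ε * (1 / 2) ^ (n + 2)) := by ring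
      rw [show n + 1 + 1 = n + 2 by ring]
      linarith
  refine exists_lt_of_mem_tailCombos (hτ N) (lt_of_lt_of_le ?_ (hlow N))
  have : 0 < ε * (1 / 2 : ℝ) ^ (N + 1) := by positivity
  linarith

end TailCombos

/-! ### Subsequences whose cluster points are indistinguishable by suprema -/

lemma exists_strictMono_eventually_mem {P : ℕ → Set ℕ → Prop}
    (h : ∀ i (M : Set ℕ), M.Infinite → ∃ M' ⊆ M, M'.Infinite ∧ P i M') :
    ∃ φ : ℕ → ℕ, StrictMono φ ∧ ∀ i, ∃ M, P i M ∧ ∀ᶠ n in atTop, φ n ∈ M := by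
  have h' : ∀ i (M : {M : Set ℕ // M.Infinite}), ∃ M' : {M : Set ℕ // M.Infinite},
      M'.1 ⊆ M.1 ∧ P i M'.1 := fun i M => by
    obtain ⟨M', h1, h2, h3⟩ := h i M.1 M.2
    exact ⟨⟨M', h2⟩, h1, h3⟩
  choose T hT hTP using h'
  let M : ℕ → {M : Set ℕ // M.Infinite} := fun n =>
    Nat.rec ⟨Set.univ, Set.infinite_univ⟩ (fun i M => T i M) n
  have hM : Antitone fun n => (M n).1 := antitone_nat_of_succ_le fun n => hT n (M n)
  obtain ⟨φ, hφ, hφM⟩ := extraction_forall_of_frequently (P := fun n k => k ∈ (M n).1)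
    fun n => Nat.frequently_atTop_iff_infinite.2 (M n).2
  exact ⟨φ, hφ, fun i => ⟨(M (i + 1)).1, hTP i (M i),
    (eventually_ge_atTop (i + 1)).mono fun n hn => hM hn (hφM n)⟩⟩

section Cluster

variable {Z : Type*} {f : ℕ → Z → ℝ} {c : Z → ℝ} {L : ℝ}

lemma MapClusterPt.frequently_abs_sub_lt {l : Filter ℕ} (hc : MapClusterPt c l f) (x : Z)
    {δ : ℝ} (hδ : 0 < δ) : ∃ᶠ n in l, |f n x - c x| < δ := by
  have := hc.continuousAt_comp (f := fun g : Z → ℝ => g x) (continuous_apply x).continuousAt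
  exact this.frequently (Metric.ball_mem_nhds _ hδ)

lemma MapClusterPt.abs_apply_le {l : Filter ℕ} (hc : MapClusterPt c l f)
    (hf : ∀ n x, |f n x| ≤ L) (x : Z) : |c x| ≤ L := by
  refine le_of_forall_pos_le_add fun δ hδ => ?_
  obtain ⟨n, hn⟩ := (hc.frequently_abs_sub_lt x hδ).exists
  have h1 := hf n x
  have h2 := abs_sub_abs_le_abs_sub (c x) (f n x)
  rw [abs_sub_comm] at h2
  linarith

lemma exists_mapClusterPt_of_abs_le (hf : ∀ n x, |f n x| ≤ L) :
    ∃ c, MapClusterPt c atTop f := by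
  have hK : IsCompact (Set.pi Set.univ fun _ : Z => Set.Icc (-L) L) :=
    isCompact_univ_pi fun _ => isCompact_Icc
  obtain ⟨c, -, hc⟩ := hK.exists_mapClusterPt (u := f) (f := atTop)
    (le_principal_iff.2 <| Filter.mem_map.2 <| Filter.univ_mem' fun n x _ => abs_le.1 (hf n x))
  exact ⟨c, hc⟩

lemma exists_strictMono_forall_mapClusterPt {ι : Type*} [Countable ι] [Nonempty ι]
    (hf : ∀ n x, |f n x| ≤ L) (v : ι → Z → ℝ) (hv : ∀ i, ∃ K, ∀ x, v i x ≤ K) :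
    ∃ φ : ℕ → ℕ, StrictMono φ ∧ ∀ i c c', MapClusterPt c atTop (f ∘ φ) →
      MapClusterPt c' atTop (f ∘ φ) → ∀ x, ∀ η > 0, ∃ x', v i x - c x - η < v i x' - c' x' := by
  obtain ⟨e, he⟩ := exists_surjective_nat (ι × ℕ)
  let P : ℕ → Set ℕ → Prop := fun n M => ∀ c c', MapClusterPt c (atTop ⊓ 𝓟 M) f →
    MapClusterPt c' (atTop ⊓ 𝓟 M) f → ∀ x, ∃ x',
      v (e n).1 x - c x - 1 / ((e n).2 + 1 : ℝ) < v (e n).1 x' - c' x'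
  obtain ⟨φ, hφ, hP⟩ := exists_strictMono_eventually_mem (P := P) (by
    intro n M hM
    set i := (e n).1
    set η : ℝ := 1 / ((e n).2 + 1 : ℝ)
    have hη : 0 < η := by positivity
    obtain ⟨K, hK⟩ := hv i
    set S := {t | ∃ x c, MapClusterPt c (atTop ⊓ 𝓟 M) f ∧ t = v i x - c x}
    by_cases hS : S.Nonempty
    · have hbdd : BddAbove S := by
        refine ⟨K + L, ?_⟩
        rintro _ ⟨x, c, hc, rfl⟩
        have := (abs_le.1 (hc.abs_apply_le hf x)).1
        linarith [hK x]
      obtain ⟨_, ⟨x₁, c₁, hc₁, rfl⟩, hlt⟩ :=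
        exists_lt_of_lt_csSup hS (sub_lt_self (sSup S) (half_pos hη))
      have hfreq := hc₁.frequently_abs_sub_lt x₁ (show 0 < η / 4 by positivity)
      refine ⟨{n ∈ M | |f n x₁ - c₁ x₁| < η / 4}, fun n hn => hn.1, ?_, ?_⟩
      · rw [← Nat.frequently_atTop_iff_infinite]
        exact frequently_inf_principal.1 hfreq
      · intro c c' hc hc' x
        refine ⟨x₁, ?_⟩
        have h1 : v i x - c x ≤ sSup S := le_csSup hbdd ⟨x, c,
          hc.mono (inf_le_inf_left _ (principal_mono.2 fun n hn => hn.1)), rfl⟩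
        obtain ⟨m, hm, hm'⟩ := ((hc'.frequently_abs_sub_lt x₁
          (show 0 < η / 4 by positivity)).and_eventually
            (mem_inf_of_right (mem_principal_self _))).exists
        have h2 := abs_lt.1 hm
        have h3 := abs_lt.1 hm'.2
        change v i x - c x - η < v i x₁ - c' x₁
        linarith
    · exact ⟨M, subset_rfl, hM, fun c c' hc hc' x => (hS ⟨_, x, c, hc, rfl⟩).elim⟩)
  refine ⟨φ, hφ, fun i c c' hc hc' x η hη => ?_⟩
  obtain ⟨j, hj⟩ := exists_nat_one_div_lt hη
  obtain ⟨n, hn⟩ := he (i, j)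
  obtain ⟨M, hPM, hφM⟩ := hP n
  have hle : map φ atTop ≤ atTop ⊓ 𝓟 M := le_inf hφ.tendsto_atTop (le_principal_iff.2 hφM)
  have key : ∀ {c}, MapClusterPt c atTop (f ∘ φ) → MapClusterPt c (atTop ⊓ 𝓟 M) f := by
    intro c hc
    exact MapClusterPt.mono (F := map φ atTop) (by rwa [MapClusterPt, Filter.map_map]) hle
  obtain ⟨x', hx'⟩ := hPM c c' (key hc) (key hc') x
  rw [hn] at hx'
  exact ⟨x', by dsimp only at hx'; linarith⟩

lemma exists_rat_sum_approx {a : ℕ → ℝ} (ha : Summable fun n => |a n|) (hL : 0 ≤ L) {ε : ℝ}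
    (hε : 0 < ε) : ∃ (N : ℕ) (q : Fin N → ℚ), ∀ y : ℕ → ℝ, (∀ n, |y n| ≤ L) →
      |∑' n, a n * y n - ∑ i : Fin N, (q i : ℝ) * y i| ≤ ε := by
  set δ := ε / (2 * (L + 1)) with hδ_def
  have hδ : 0 < δ := by positivity
  obtain ⟨N, hN⟩ := ((tendsto_sum_nat_add fun n => |a n|).eventually_lt_const hδ).exists
  have hq : ∀ i : Fin N, ∃ q : ℚ, |a i - q| < δ / (N + 1) := fun i => by
    obtain ⟨q, hq⟩ := exists_rat_near (a i) (show 0 < δ / (N + 1) by positivity)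
    exact ⟨q, hq⟩
  choose q hq using hq
  refine ⟨N, q, fun y hy => ?_⟩
  have hbd : ∀ n, ‖a n * y n‖ ≤ |a n| * L := fun n => by
    rw [norm_mul]
    exact mul_le_mul_of_nonneg_left (hy n) (abs_nonneg _)
  have hs : Summable fun n => a n * y n := Summable.of_norm_bounded (ha.mul_right L) hbd
  rw [← hs.sum_add_tsum_nat_add N, ← Fin.sum_univ_eq_sum_range (fun n => a n * y n) N,
    add_sub_right_comm, ← Finset.sum_sub_distrib]
  have h1 : |∑ i : Fin N, (a i * y i - q i * y i)| ≤ δ * L := by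
    refine (Finset.abs_sum_le_sum_abs _ _).trans ?_
    refine (Finset.sum_le_card_nsmul _ _ (δ / (N + 1) * L) fun i _ => ?_).trans ?_
    · rw [← sub_mul, abs_mul]
      exact mul_le_mul (hq i).le (hy i) (abs_nonneg _) (by positivity)
    · simp only [Finset.card_univ, Fintype.card_fin, nsmul_eq_mul]
      rw [← mul_assoc]
      refine mul_le_mul_of_nonneg_right ?_ hL
      rw [mul_div_assoc', div_le_iff₀ (by positivity)]
      nlinarith
  have h2 : |∑' n, a (n + N) * y (n + N)| ≤ δ * L := by
    have hs' : Summable fun n => |a (n + N)| * L :=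
      ((summable_nat_add_iff N).2 ha).mul_right L
    refine (tsum_of_norm_bounded hs'.hasSum fun n => hbd _).trans ?_
    rw [tsum_mul_right]
    exact mul_le_mul_of_nonneg_right hN.le hL
  have h3 : δ * L + δ * L ≤ ε := by
    have : ε = δ * (2 * (L + 1)) := by rw [hδ_def]; field_simp
    nlinarith
  exact (abs_add_le _ _).trans (by linarith)

/-- Every bounded sequence of functions has a subsequence such that, for every absolutely
convergent combination `u` of the sequence, the supremum of `u - c` is the same for all cluster
points `c` of the subsequence. -/
lemma exists_strictMono_forall_tsum_sub (hf : ∀ n x, |f n x| ≤ L) (hL : 0 ≤ L) :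
    ∃ φ : ℕ → ℕ, StrictMono φ ∧ ∀ (a : ℕ → ℝ) (g : ℕ → ℕ), (Summable fun n => |a n|) →
      ∀ c c', MapClusterPt c atTop (f ∘ φ) → MapClusterPt c' atTop (f ∘ φ) →
        ∀ x, ∀ η > 0, ∃ x', ∑' n, a n * f (g n) x - c x - η < ∑' n, a n * f (g n) x' - c' x' := by
  obtain ⟨φ, hφ, h⟩ := exists_strictMono_forall_mapClusterPt
    (ι := Σ N : ℕ, Fin N → ℚ × ℕ) hf (fun p x => ∑ i, ((p.2 i).1 : ℝ) * f (p.2 i).2 x)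
    (fun p => ⟨∑ i, |((p.2 i).1 : ℝ)| * L, fun x => Finset.sum_le_sum fun i _ => by
      refine (le_abs_self _).trans ?_
      rw [abs_mul]
      exact mul_le_mul_of_nonneg_left (hf _ _) (abs_nonneg _)⟩)
  refine ⟨φ, hφ, fun a g ha c c' hc hc' x η hη => ?_⟩
  obtain ⟨N, q, hq⟩ := exists_rat_sum_approx ha hL (show 0 < η / 4 by positivity)
  obtain ⟨x', hx'⟩ := h ⟨N, fun i => (q i, g i)⟩ c c' hc hc' x (η / 4) (by positivity)
  have h1 := abs_le.1 (hq (fun n => f (g n) x) fun n => hf _ _)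
  have h2 := abs_le.1 (hq (fun n => f (g n) x') fun n => hf _ _)
  exact ⟨x', by dsimp only at hx' h1 h2; linarith⟩

end Cluster

/-! ### Attainment of suprema and interchange of iterated limits -/

section Attain

variable {Z : Type*} {f : ℕ → Z → ℝ} {L δ : ℝ}

lemma summable_mul_of_abs_le {a y : ℕ → ℝ} (ha : Summable fun n => |a n|)
    (hy : ∀ n, |y n| ≤ L) : Summable fun n => a n * y n :=
  Summable.of_norm_bounded (ha.mul_right L) fun n => by
    rw [norm_mul]
    exact mul_le_mul_of_nonneg_left (hy n) (abs_nonneg _)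

lemma tailCombos_of_add {v : ℕ → Z → ℝ} {N : ℕ} {u : Z → ℝ} (k : Z → ℝ)
    (hu : u ∈ tailCombos (fun n x => v n x + k x) N) : u - k ∈ tailCombos v N := by
  obtain ⟨lam, h0, h1, h2, h3⟩ := hu
  refine ⟨lam, h0, h1, h2, fun x => ?_⟩
  have := (h3 x).sub (h2.mul_right (k x))
  rw [one_mul] at this
  have h : (fun n => lam n * v n x) = fun n => lam n * (v n x + k x) - lam n * k x := by
    funext n
    ring
  rw [h]
  exact this

/-- The strictly concave perturbation used to make maximisers unique. -/
def concavePerturbation (L κ : ℝ) (t y : ℕ → ℝ) : ℝ :=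
  ∑' i, κ * (1 / 2) ^ (i + 1) * (t i * y i - L / 2 * t i ^ 2)

lemma abs_mul_sub_half_sq_sub_le {s t y : ℝ} (hL : 0 < L) (hy : |y| ≤ L) (hs : |s| ≤ 1)
    (ht : |t| ≤ 1) :
    |(t * y - L / 2 * t ^ 2) - (s * y - L / 2 * s ^ 2)| ≤ 2 * L * |t - s| := by
  have h : (t * y - L / 2 * t ^ 2) - (s * y - L / 2 * s ^ 2)
      = (y - L / 2 * (t + s)) * (t - s) := by ring
  rw [h, abs_mul]
  refine mul_le_mul_of_nonneg_right ?_ (abs_nonneg _)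
  rw [abs_le] at *
  constructor <;> nlinarith

lemma abs_mul_sub_half_sq_le {t y : ℝ} (hL : 0 < L) (hy : |y| ≤ L) (ht : |t| ≤ 1) :
    |t * y - L / 2 * t ^ 2| ≤ 2 * L := by
  have := abs_mul_sub_half_sq_sub_le hL hy (s := 0) (by simp) ht
  simp only [zero_mul, sub_zero, zero_pow two_ne_zero, mul_zero] at this
  nlinarith

lemma summable_concavePerturbation (κ : ℝ) (hL : 0 < L) {t y : ℕ → ℝ}
    (ht : ∀ i, |t i| ≤ 1) (hy : ∀ i, |y i| ≤ L) :
    Summable fun i => κ * (1 / 2) ^ (i + 1) * (t i * y i - L / 2 * t i ^ 2) := by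
  simp only [mul_assoc κ]
  exact (summable_half_pow_mul fun k => abs_mul_sub_half_sq_le hL (hy k) (ht k)).mul_left κ

lemma abs_concavePerturbation_le {κ : ℝ} (hκ : 0 < κ) (hL : 0 < L) {t y : ℕ → ℝ}
    (ht : ∀ i, |t i| ≤ 1) (hy : ∀ i, |y i| ≤ L) :
    |concavePerturbation L κ t y| ≤ κ * (2 * L) := by
  have h : HasSum (fun i : ℕ => κ * (1 / 2) ^ (i + 1) * (2 * L)) (κ * (2 * L)) := by
    simpa using (hasSum_half_pow_succ.mul_left κ).mul_right (2 * L)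
  rw [concavePerturbation, ← Real.norm_eq_abs]
  refine tsum_of_norm_bounded h fun i => ?_
  rw [norm_mul, Real.norm_of_nonneg (by positivity)]
  exact mul_le_mul_of_nonneg_left (abs_mul_sub_half_sq_le hL (hy i) (ht i)) (by positivity)

lemma abs_concavePerturbation_sub_le {κ : ℝ} (hκ : 0 < κ) (hL : 0 < L) {s t y : ℕ → ℝ}
    (hs : ∀ i, |s i| ≤ 1) (ht : ∀ i, |t i| ≤ 1) (hy : ∀ i, |y i| ≤ L) :
    |concavePerturbation L κ t y - concavePerturbation L κ s y| ≤
      ∑' i, κ * (1 / 2) ^ (i + 1) * (2 * L * |t i - s i|) := by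
  have hsum : Summable fun i => κ * (1 / 2) ^ (i + 1) * (2 * L * |t i - s i|) := by
    simp only [mul_assoc κ]
    refine (summable_half_pow_mul (K := 2 * L * 2) fun k => ?_).mul_left κ
    rw [abs_mul, abs_abs, abs_of_pos (by positivity : 0 < 2 * L)]
    refine mul_le_mul_of_nonneg_left ?_ (by positivity)
    have := abs_sub (t k) (s k)
    linarith [hs k, ht k]
  rw [concavePerturbation, concavePerturbation,
    ← (summable_concavePerturbation κ hL ht hy).tsum_sub (summable_concavePerturbation κ hL hs hy),
    ← Real.norm_eq_abs]
  refine tsum_of_norm_bounded hsum.hasSum fun i => ?_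
  rw [← mul_sub, norm_mul, Real.norm_of_nonneg (by positivity)]
  exact mul_le_mul_of_nonneg_left (abs_mul_sub_half_sq_sub_le hL (hy i) (hs i) (ht i))
    (by positivity)

lemma eq_of_concavePerturbation_le {κ : ℝ} (hκ : 0 < κ) (hL : 0 < L) {s y : ℕ → ℝ}
    (hs : ∀ i, |s i| ≤ 1) (hy : ∀ i, |y i| ≤ L)
    (h : ∀ t : ℕ → ℝ, (∀ i, |t i| ≤ 1) → concavePerturbation L κ t y ≤ concavePerturbation L κ s y)
    (j : ℕ) : y j = L * s j := by
  have hyL : |y j / L| ≤ 1 := by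
    rw [abs_div, abs_of_pos hL]
    exact (div_le_one hL).2 (hy j)
  have ht : ∀ i, |Function.update s j (y j / L) i| ≤ 1 := fun i => by
    by_cases hi : i = j
    · subst hi; simpa using hyL
    · simpa [hi] using hs i
  have h1 := h _ ht
  rw [← sub_nonpos, concavePerturbation, concavePerturbation,
    ← (summable_concavePerturbation κ hL ht hy).tsum_sub
      (summable_concavePerturbation κ hL hs hy), tsum_eq_single j, ← mul_sub] at h1
  · rw [Function.update_self] at h1
    have h2 : y j / L * y j - L / 2 * (y j / L) ^ 2 - (s j * y j - L / 2 * s j ^ 2)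
        = (y j - L * s j) ^ 2 / (2 * L) := by
      field_simp
      ring
    rw [h2] at h1
    have h3 : (y j - L * s j) ^ 2 / (2 * L) ≤ 0 :=
      nonpos_of_mul_nonpos_right h1 (by positivity)
    have h4 : (y j - L * s j) ^ 2 ≤ 0 := by
      rwa [div_le_iff₀ (by positivity), zero_mul] at h3
    exact sub_eq_zero.1 (pow_eq_zero_iff two_ne_zero |>.1 (le_antisymm h4 (sq_nonneg _)))
  · intro i hi
    simp [hi]

lemma add_concavePerturbation (κ : ℝ) (hL : 0 < L) {a t y : ℕ → ℝ}
    (ha : Summable fun n => |a n|) (ht : ∀ i, |t i| ≤ 1) (hy : ∀ i, |y i| ≤ L) :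
    ∑' i, a i * y i + concavePerturbation L κ t y =
      ∑' i, (a i + κ * (1 / 2) ^ (i + 1) * t i) * y i
        - L / 2 * ∑' i, κ * (1 / 2) ^ (i + 1) * t i ^ 2 := by
  have h1 : Summable fun i => κ * (1 / 2) ^ (i + 1) * t i ^ 2 := by
    simp only [mul_assoc κ]
    refine (summable_half_pow_mul (K := 1) fun k => ?_).mul_left κ
    rw [abs_pow]
    exact pow_le_one₀ (abs_nonneg _) (ht k)
  have h2 : Summable fun i => (a i + κ * (1 / 2) ^ (i + 1) * t i) * y i := by
    have := (summable_mul_of_abs_le ha hy).add ((summable_concavePerturbation κ hL ht hy).add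
      (h1.mul_left (L / 2)))
    refine this.congr fun i => ?_
    ring
  rw [concavePerturbation, ← (summable_mul_of_abs_le ha hy).tsum_add
    (summable_concavePerturbation κ hL ht hy), ← tsum_mul_left, ← h2.tsum_sub (h1.mul_left _)]
  exact tsum_congr fun i => by ring

lemma summable_abs_add_half_pow_mul {κ : ℝ} {a t : ℕ → ℝ}
    (ha : Summable fun n => |a n|) (ht : ∀ i, |t i| ≤ 1) :
    Summable fun i => |a i + κ * (1 / 2) ^ (i + 1) * t i| := by
  refine (Summable.add (Summable.of_abs ha) ?_).abs
  simp only [mul_assoc κ]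
  exact (summable_half_pow_mul ht).mul_left κ

lemma not_forall_lt_sub_of_attains [Nonempty Z] (hL : 0 < L) (hδ : 0 < δ)
    (hf : ∀ n x, |f n x| ≤ L)
    (hatt : ∀ a : ℕ → ℝ, (Summable fun n => |a n|) → ∀ c, MapClusterPt c atTop f →
      ∃ x₀, ∀ x, ∑' n, a n * f n x - c x ≤ ∑' n, a n * f n x₀ - c x₀)
    (hpryce : ∀ a : ℕ → ℝ, (Summable fun n => |a n|) → ∀ c c', MapClusterPt c atTop f →
      MapClusterPt c' atTop f → ∀ x, ∀ η > 0, ∃ x',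
        ∑' n, a n * f n x - c x - η < ∑' n, a n * f n x' - c' x')
    {c₀ : Z → ℝ} (hc₀ : MapClusterPt c₀ atTop f)
    (hsup : ∀ u ∈ tailCombos f 0, ∀ B < δ, ∃ x, B < u x - c₀ x) : False := by
  set κ := δ / (8 * L) with hκ_def
  have hκ : 0 < κ := by positivity
  have hκL : κ * (2 * L) = δ / 4 := by rw [hκ_def]; field_simp; ring
  let C := ℕ → Set.Icc (-1 : ℝ) 1
  let t₀ : C := fun _ => ⟨0, by simp⟩
  have : Nonempty C := ⟨t₀⟩
  let co : C → ℕ → ℝ := fun t i => t i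
  have hco : ∀ t i, |co t i| ≤ 1 := fun t i => abs_le.2 (t i).2
  have hfx : ∀ x i, |f i x| ≤ L := fun x i => hf i x
  let P : Z → C → ℝ := fun x t => concavePerturbation L κ (co t) fun i => f i x
  have hP : ∀ x t, |P x t| ≤ δ / 4 := fun x t =>
    hκL ▸ abs_concavePerturbation_le hκ hL (hco t) (hfx x)
  have hc₀L := hc₀.abs_apply_le hf
  -- a convex combination attaining its supremum only where the conclusion above holds
  obtain ⟨u, hu, hmax⟩ := exists_tailCombo_frequently_lt (Z := Z × C)
    (v := fun n z => f n z.1 + (P z.1 z.2 - c₀ z.1)) (K := L + (δ / 4 + L)) (A := δ) (ε := δ / 4)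
    (fun n z => (abs_add_le _ _).trans (add_le_add (hf _ _)
      ((abs_sub _ _).trans (add_le_add (hP _ _) (hc₀L _))))) (by positivity) (by
    intro u hu B hB
    have hP0 : ∀ x, P x t₀ = 0 := fun x => by simp [P, co, t₀, concavePerturbation]
    have hw : (fun x => u (x, t₀) + c₀ x) ∈ tailCombos f 0 := by
      obtain ⟨lam, h0, h1, h2, h3⟩ := tailCombos_of_add (v := fun n (z : Z × C) => f n z.1) _ hu
      refine ⟨lam, h0, h1, h2, fun x => ?_⟩
      have := h3 (x, t₀)
      simpa [hP0] using this
    obtain ⟨x, hx⟩ := hsup _ hw B hB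
    exact ⟨(x, t₀), by simpa using hx⟩)
  obtain ⟨lam, lam0, -, hlam, hlamu⟩ :=
    tailCombos_of_add (v := fun n (z : Z × C) => f n z.1) _ hu
  have hlam' : Summable fun n => |lam n| := hlam.summable.abs
  let S : (ℕ → ℝ) → Z → ℝ := fun a x => ∑' n, a n * f n x
  let a : C → ℕ → ℝ := fun t i => lam i + κ * (1 / 2) ^ (i + 1) * co t i
  have ha : ∀ t, Summable fun n => |a t n| := fun t => summable_abs_add_half_pow_mul hlam' (hco t)
  let Q : C → ℝ := fun t => L / 2 * ∑' i, κ * (1 / 2) ^ (i + 1) * co t i ^ 2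
  have hSa : ∀ x t, S lam x + P x t = S (a t) x - Q t := fun x t =>
    add_concavePerturbation κ hL hlam' (hco t) (hfx x)
  have hu_eq : ∀ x t, u (x, t) = S lam x - c₀ x + P x t := by
    intro x t
    have := (hlamu (x, t)).tsum_eq
    simp only [Pi.sub_apply] at this
    change S lam x = _ at this
    linarith
  have hSbdd : ∀ a : ℕ → ℝ, (Summable fun n => |a n|) → ∀ x, |S a x| ≤ (∑' n, |a n|) * L := by
    intro a ha x
    rw [← Real.norm_eq_abs, ← tsum_mul_right]
    refine tsum_of_norm_bounded (ha.mul_right L).hasSum fun n => ?_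
    rw [norm_mul]
    exact mul_le_mul_of_nonneg_left (hf n x) (abs_nonneg _)
  have hubdd : ∀ t, BddAbove (Set.range fun x => u (x, t)) := by
    intro t
    refine ⟨(∑' n, |lam n|) * L + L + δ / 4, ?_⟩
    rintro _ ⟨x, rfl⟩
    dsimp only
    rw [hu_eq]
    have h1 := (abs_le.1 (hSbdd _ hlam' x)).2
    have h2 := (abs_le.1 (hc₀L x)).1
    have h3 := (abs_le.1 (hP x t)).2
    linarith
  -- the marginal supremum is continuous in the parameter
  let ψ : C → ℝ := fun t => ⨆ x, u (x, t)
  let d : C → C → ℝ := fun s t => ∑' i, κ * (1 / 2) ^ (i + 1) * (2 * L * |co t i - co s i|)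
  have hψ_le : ∀ s t, ψ t ≤ ψ s + d s t := by
    intro s t
    refine ciSup_le fun x => ?_
    have h1 := (abs_le.1 (abs_concavePerturbation_sub_le hκ hL (hco s) (hco t) (hfx x))).2
    have h2 : u (x, s) ≤ ψ s := le_ciSup (hubdd s) x
    rw [hu_eq] at h2 ⊢
    change P x t - P x s ≤ d s t at h1
    linarith
  have hd_symm : ∀ s t, d s t = d t s := fun s t => by simp only [d, abs_sub_comm]
  have hψ : Continuous ψ := by
    refine continuous_iff_continuousAt.2 fun s => ?_
    have hdc : Continuous (d s) := by
      refine continuous_tsum (u := fun i => κ * ((1 / 2) ^ (i + 1) * (2 * L * 2)))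
        (fun i => ?_) ((summable_half_pow_mul fun k => le_rfl).mul_left κ) fun i t => ?_
      · have : Continuous fun t : C => co t i := continuous_subtype_val.comp (continuous_apply i)
        fun_prop
      · rw [norm_mul, Real.norm_of_nonneg (by positivity), mul_assoc]
        refine mul_le_mul_of_nonneg_left (mul_le_mul_of_nonneg_left ?_ (by positivity)) hκ.le
        rw [norm_mul, Real.norm_of_nonneg (by positivity), Real.norm_eq_abs, abs_abs]
        refine mul_le_mul_of_nonneg_left ?_ (by positivity)
        have := abs_sub (co t i) (co s i)
        linarith [hco t i, hco s i]
    have hd0 : Tendsto (d s) (𝓝 s) (𝓝 0) := by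
      have := hdc.tendsto s
      rwa [show d s s = 0 by simp [d]] at this
    refine tendsto_iff_norm_sub_tendsto_zero.2 (squeeze_zero (fun _ => norm_nonneg _) (fun t => ?_)
      hd0)
    rw [Real.norm_eq_abs, abs_le]
    have h1 := hψ_le s t
    have h2 := hψ_le t s
    rw [hd_symm] at h2
    constructor <;> linarith
  obtain ⟨t, -, ht⟩ := isCompact_univ.exists_isMaxOn (f := ψ) Set.univ_nonempty hψ.continuousOn
  have ht : ∀ s, ψ s ≤ ψ t := fun s => ht (Set.mem_univ s)
  obtain ⟨x₀, hx₀⟩ := hatt (a t) (ha t) c₀ hc₀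
  have hu_eq' : ∀ x s, u (x, s) = S (a s) x - c₀ x - Q s := fun x s => by
    linarith [hu_eq x s, hSa x s]
  have hψt : ψ t ≤ u (x₀, t) := ciSup_le fun x => by
    rw [hu_eq', hu_eq']
    exact sub_le_sub_right (hx₀ x) _
  have humax : ∀ x s, u (x, s) ≤ u (x₀, t) := fun x s =>
    ((le_ciSup (hubdd s) x).trans (ht s)).trans hψt
  have hval : ∀ c, MapClusterPt c atTop f → ∀ x, (∀ x', S (a t) x' - c x' ≤ S (a t) x - c x) →
      S (a t) x - c x = S (a t) x₀ - c₀ x₀ := by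
    intro c hc x hx
    apply le_antisymm
    · refine le_of_forall_pos_le_add fun η hη => ?_
      obtain ⟨x', hx'⟩ := hpryce (a t) (ha t) c c₀ hc hc₀ x η hη
      have := hx₀ x'
      simp only [S]
      linarith
    · refine le_of_forall_pos_le_add fun η hη => ?_
      obtain ⟨x', hx'⟩ := hpryce (a t) (ha t) c₀ c hc₀ hc x₀ η hη
      have := hx x'
      simp only [S] at this ⊢
      linarith
  have hcoord : ∀ c, MapClusterPt c atTop f → ∀ x,
      (∀ x', S (a t) x' - c x' ≤ S (a t) x - c x) → ∀ j, f j x = L * co t j := by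
    intro c hc x hx
    refine eq_of_concavePerturbation_le (y := fun i => f i x) hκ hL (hco t) (hfx x) fun s hs => ?_
    obtain ⟨s, rfl⟩ : ∃ s' : C, co s' = s := ⟨fun i => ⟨s i, abs_le.1 (hs i)⟩, rfl⟩
    change P x s ≤ P x t
    have h1 := hval c hc x hx
    have h2 : S (a s) x - c x - Q s ≤ u (x₀, t) := by
      refine le_of_forall_pos_le_add fun η hη => ?_
      obtain ⟨x', hx'⟩ := hpryce (a s) (ha s) c c₀ hc hc₀ x η hη
      have := humax x' s
      rw [hu_eq'] at this
      simp only [S] at this ⊢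
      linarith
    rw [hu_eq'] at h2
    linarith [hSa x s, hSa x t]
  have hfreq : ∀ N, ∃ n ≥ N, c₀ x₀ + δ / 2 < f n x₀ := by
    intro N
    obtain ⟨n, hn, h⟩ := hmax (x₀, t) (fun z => humax z.1 z.2) N
    have := (abs_le.1 (hP x₀ t)).2
    exact ⟨n, hn, by dsimp only at h; linarith⟩
  obtain ⟨φ, hφ, hφx⟩ := extraction_of_frequently_atTop (frequently_atTop.2 hfreq)
  obtain ⟨c, hc⟩ := exists_mapClusterPt_of_abs_le (f := f ∘ φ) fun n x => hf _ _
  have hcf : MapClusterPt c atTop f := MapClusterPt.of_comp hφ.tendsto_atTop hc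
  obtain ⟨x, hx⟩ := hatt (a t) (ha t) c hcf
  have hcoord_eq : ∀ j, f j x = f j x₀ := fun j =>
    (hcoord c hcf x hx j).trans (hcoord c₀ hc₀ x₀ hx₀ j).symm
  have h1 := hval c hcf x hx
  have h2 : S (a t) x = S (a t) x₀ := tsum_congr fun j => by rw [hcoord_eq]
  obtain ⟨n, hn⟩ := (hc.frequently_abs_sub_lt x (half_pos hδ)).exists
  have h3 := (abs_lt.1 hn).2
  have h4 := hφx n
  rw [Function.comp_apply, hcoord_eq] at h3
  linarith

/-- If all the functions `∑ a n * f (g n) - c`, with `c` a cluster point of `f`, attain their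
suprema, then the iterated limits of `f` along a sequence of points cannot differ. -/
lemma not_iterated_limits_of_attains (hL : 0 < L) (hδ : 0 < δ) (hf : ∀ n x, |f n x| ≤ L)
    (hatt : ∀ (a : ℕ → ℝ) (g : ℕ → ℕ), (Summable fun n => |a n|) → ∀ c, MapClusterPt c atTop f →
      ∃ x₀, ∀ x, ∑' n, a n * f (g n) x - c x ≤ ∑' n, a n * f (g n) x₀ - c x₀)
    {x : ℕ → Z} {p r : ℕ → ℝ} {q : ℝ} (hp : ∀ n, Tendsto (fun k => f n (x k)) atTop (𝓝 (p n)))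
    (hpq : ∀ n, q + δ ≤ p n) (hr : ∀ k, Tendsto (fun n => f n (x k)) atTop (𝓝 (r k)))
    (hrq : Tendsto r atTop (𝓝 q)) : False := by
  have : Nonempty Z := ⟨x 0⟩
  obtain ⟨φ, hφ, hpryce⟩ := exists_strictMono_forall_tsum_sub hf hL.le
  have hcl : ∀ {c}, MapClusterPt c atTop (f ∘ φ) → MapClusterPt c atTop f := fun hc =>
    MapClusterPt.of_comp hφ.tendsto_atTop hc
  obtain ⟨c₀, hc₀⟩ := exists_mapClusterPt_of_abs_le (f := f ∘ φ) fun n x => hf _ _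
  refine not_forall_lt_sub_of_attains (f := f ∘ φ) hL hδ (fun n x => hf _ _)
    (fun a ha c hc => hatt a φ ha c (hcl hc)) (fun a ha => hpryce a φ ha) hc₀ ?_
  rintro u ⟨lam, lam0, -, hlam, hu⟩ B hB
  have hc₀x : ∀ k, c₀ (x k) = r k := fun k => by
    by_contra hne
    have hpos : 0 < |c₀ (x k) - r k| / 2 := half_pos (abs_pos.2 (sub_ne_zero.2 hne))
    obtain ⟨n, h1, h2⟩ := (((hcl hc₀).frequently_abs_sub_lt (x k) hpos).and_eventually
      ((hr k).eventually (Metric.ball_mem_nhds _ hpos))).exists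
    have h2 : |f n (x k) - r k| < |c₀ (x k) - r k| / 2 := h2
    have h3 := abs_sub_le (c₀ (x k)) (f n (x k)) (r k)
    rw [abs_sub_comm] at h1
    linarith
  have hu' : ∀ y, u y = ∑' n, lam n * f (φ n) y := fun y => (hu y).tsum_eq.symm
  have hlim : Tendsto (fun k => u (x k)) atTop (𝓝 (∑' n, lam n * p (φ n))) := by
    simp only [hu']
    refine tendsto_tsum_of_dominated_convergence (hlam.summable.mul_right L)
      (fun n => (hp (φ n)).const_mul _) (Filter.Eventually.of_forall fun k n => ?_)
    rw [norm_mul, Real.norm_of_nonneg (lam0 n)]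
    exact mul_le_mul_of_nonneg_left (hf _ _) (lam0 n)
  have hpL : ∀ n, |p n| ≤ L := fun n => le_of_tendsto (hp n).abs
    (Filter.Eventually.of_forall fun k => hf _ _)
  have hge : q + δ ≤ ∑' n, lam n * p (φ n) := by
    have h := hlam.mul_right (q + δ)
    rw [one_mul] at h
    exact hasSum_le (fun n => mul_le_mul_of_nonneg_left (hpq _) (lam0 n)) h
      (summable_mul_of_abs_le hlam.summable.abs fun n => hpL (φ n)).hasSum
  have hlim' : Tendsto (fun k => u (x k) - c₀ (x k)) atTop (𝓝 (∑' n, lam n * p (φ n) - q)) := by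
    simp only [hc₀x]
    exact hlim.sub hrq
  obtain ⟨k, hk⟩ := (hlim'.eventually_const_lt (show B < _ by linarith)).exists
  exact ⟨x k, hk⟩

end Attain

/-! ### Functionals on the dual given by ultrafilters on a bounded set -/

lemma tendsto_of_abs_sub_le_one_div {g : ℕ → ℝ} {l : ℝ}
    (h : ∀ᶠ k : ℕ in atTop, |g k - l| ≤ 1 / (k + 1 : ℝ)) : Tendsto g atTop (𝓝 l) :=
  tendsto_iff_norm_sub_tendsto_zero.2
    (squeeze_zero' (Eventually.of_forall fun _ => norm_nonneg _) h
      tendsto_one_div_add_atTop_nhds_zero_nat)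

lemma exists_finite_net {α ι : Type*} [Finite ι] {S : Set α} (g : ι → α → ℝ) {K : ℝ}
    (hg : ∀ i, ∀ a ∈ S, |g i a| ≤ K) {η : ℝ} (hη : 0 < η) :
    ∃ T ⊆ S, T.Finite ∧ ∀ d ∈ S, ∃ a ∈ T, ∀ i, |g i a - g i d| < η := by
  have := Fintype.ofFinite ι
  let Φ : α → ι → ℝ := fun a i => g i a
  have hb : TotallyBounded (Φ '' S) := by
    have hc : IsCompact (Set.pi Set.univ fun _ : ι => Set.Icc (-K) K) :=
      isCompact_univ_pi fun _ => isCompact_Icc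
    refine hc.totallyBounded.subset ?_
    rintro _ ⟨a, ha, rfl⟩ i -
    exact abs_le.1 (hg i a ha)
  obtain ⟨T, hTS, hTf, hT⟩ := Set.exists_subset_image_finite_and.1
    (hb.exists_subset (Metric.dist_mem_uniformity hη))
  refine ⟨T, hTS, hTf, fun d hd => ?_⟩
  obtain ⟨_, ⟨a, ha, rfl⟩, hda⟩ := Set.mem_iUnion₂.1 (hT ⟨d, hd, rfl⟩)
  refine ⟨a, ha, fun i => ?_⟩
  have h1 : dist (Φ d) (Φ a) < η := hda
  have h2 := (dist_le_pi_dist (Φ d) (Φ a) i).trans_lt h1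
  rwa [dist_comm] at h2

section Dual

variable {Y : Type*} [NormedAddCommGroup Y] [NormedSpace ℝ Y]
  {D : Set (Y →L[ℝ] ℝ)} {F : Set Y} {R : ℝ} {𝒰 : Ultrafilter Y} {ξ : (Y →L[ℝ] ℝ) → ℝ}

lemma ContinuousLinearMap.abs_apply_le_mul (y' : Y →L[ℝ] ℝ) (hFR : ∀ x ∈ F, ‖x‖ ≤ R) {x : Y}
    (hx : x ∈ F) : |y' x| ≤ ‖y'‖ * R :=
  (y'.le_opNorm x).trans (mul_le_mul_of_nonneg_left (hFR x hx) (norm_nonneg _))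

lemma abs_apply_le_of_norm_le_one (hD : ∀ d ∈ D, ‖d‖ ≤ 1) (hFR : ∀ x ∈ F, ‖x‖ ≤ R)
    {d : Y →L[ℝ] ℝ} (hd : d ∈ D) {x : Y} (hx : x ∈ F) : |d x| ≤ R :=
  ((d.le_opNorm x).trans (mul_le_of_le_one_left (norm_nonneg _) (hD d hd))).trans (hFR x hx)

lemma exists_forall_tendsto_ultrafilter (hFR : ∀ x ∈ F, ‖x‖ ≤ R) (hF : F ∈ 𝒰) :
    ∃ ξ : (Y →L[ℝ] ℝ) → ℝ, ∀ y' : Y →L[ℝ] ℝ, Tendsto y' 𝒰 (𝓝 (ξ y')) := by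
  have h : ∀ y' : Y →L[ℝ] ℝ, ∃ l, Tendsto y' 𝒰 (𝓝 l) := fun y' => by
    obtain ⟨l, -, hl⟩ := (isCompact_Icc (a := -(‖y'‖ * R)) (b := ‖y'‖ * R)).ultrafilter_le_nhds
      (𝒰.map y') (le_principal_iff.2 <| Filter.mem_map.2 <| Filter.mem_of_superset hF fun x hx =>
        abs_le.1 (y'.abs_apply_le_mul hFR hx))
    exact ⟨l, hl⟩
  choose ξ hξ using h
  exact ⟨ξ, hξ⟩

/-- The sequential form of weak-star compactness used below: limits along ultrafilters on `ℕ`. -/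
def HasUltraLimits (D : Set (Y →L[ℝ] ℝ)) : Prop :=
  ∀ a : ℕ → Y →L[ℝ] ℝ, (∀ n, a n ∈ D) → ∀ 𝒱 : Ultrafilter ℕ,
    ∃ b ∈ D, ∀ y, Tendsto (fun n => a n y) 𝒱 (𝓝 (b y))

/-- All absolutely convergent combinations of elements of `D` attain their maximum on `F`. -/
def SeriesAttain (D : Set (Y →L[ℝ] ℝ)) (F : Set Y) : Prop :=
  ∀ (α : ℕ → ℝ) (u : ℕ → Y →L[ℝ] ℝ), (Summable fun n => |α n|) → (∀ n, u n ∈ D) →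
    ∃ x₀ ∈ F, ∀ x ∈ F, ∑' n, α n * u n x ≤ ∑' n, α n * u n x₀

lemma SeriesAttain.attains_sub (hatt : SeriesAttain D F) (hD : ∀ d ∈ D, ‖d‖ ≤ 1)
    (hFR : ∀ x ∈ F, ‖x‖ ≤ R) {s : ℝ} {α : ℕ → ℝ} {u : ℕ → Y →L[ℝ] ℝ} {e : Y →L[ℝ] ℝ}
    (hα : Summable fun n => |α n|) (hu : ∀ n, u n ∈ D) (he : e ∈ D) :
    ∃ x₀ ∈ F, ∀ x ∈ F,
      ∑' n, α n * (s * u n x) - s * e x ≤ ∑' n, α n * (s * u n x₀) - s * e x₀ := by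
  let β : ℕ → ℝ := fun n => Nat.casesOn n (-s) fun n => α n * s
  let w : ℕ → Y →L[ℝ] ℝ := fun n => Nat.casesOn n e u
  have hβ : Summable fun n => |β n| := by
    refine (summable_nat_add_iff 1).1 ?_
    simpa only [β, abs_mul] using hα.mul_right |s|
  have hw : ∀ n, w n ∈ D := fun n => by cases n with
    | zero => exact he
    | succ n => exact hu n
  obtain ⟨x₀, hx₀, hmax⟩ := hatt β w hβ hw
  have key : ∀ x ∈ F, ∑' n, β n * w n x = ∑' n, α n * (s * u n x) - s * e x := by
    intro x hx
    rw [(summable_mul_of_abs_le hβ fun n =>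
      abs_apply_le_of_norm_le_one hD hFR (hw n) hx).tsum_eq_zero_add]
    change -s * e x + ∑' n, α n * s * u n x = _
    simp only [mul_assoc]
    ring
  refine ⟨x₀, hx₀, fun x hx => ?_⟩
  rw [← key x hx, ← key x₀ hx₀]
  exact hmax x hx

lemma SeriesAttain.tendsto_of_tendsto (hatt : SeriesAttain D F) (hD : ∀ d ∈ D, ‖d‖ ≤ 1)
    (hDlim : HasUltraLimits D) (hR : 0 < R) (hFR : ∀ x ∈ F, ‖x‖ ≤ R) (hF : F ∈ 𝒰)
    (hξ : ∀ y' : Y →L[ℝ] ℝ, Tendsto y' 𝒰 (𝓝 (ξ y'))) {a : ℕ → Y →L[ℝ] ℝ} (ha : ∀ n, a n ∈ D)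
    {b : Y →L[ℝ] ℝ} {𝒱 : Ultrafilter ℕ} (hab : ∀ y, Tendsto (fun n => a n y) 𝒱 (𝓝 (b y))) :
    Tendsto (fun n => ξ (a n)) 𝒱 (𝓝 (ξ b)) := by
  by_contra hcon
  obtain ⟨ε, hε, hfar⟩ : ∃ ε > 0, ∀ᶠ n in (𝒱 : Filter ℕ), ε ≤ |ξ (a n) - ξ b| := by
    by_contra! h
    refine hcon (Metric.tendsto_nhds.2 fun ε hε => ?_)
    simpa [Real.dist_eq] using h ε hε
  obtain ⟨s, hs, hfar⟩ : ∃ s : ℝ, |s| = 1 ∧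
      ∀ᶠ n in (𝒱 : Filter ℕ), ε ≤ s * (ξ (a n) - ξ b) := by
    rcases Ultrafilter.eventually_or.1 (hfar.mono fun n hn => le_abs.1 hn) with h | h
    · exact ⟨1, by simp, by simpa using h⟩
    · exact ⟨-1, by simp, by simpa using h⟩
  have hx : ∀ k : ℕ, ∃ x ∈ F, |b x - ξ b| < 1 / (k + 1 : ℝ) ∧
      ∀ j ∈ Set.Iic k, |a j x - ξ (a j)| < 1 / (k + 1 : ℝ) := by
    intro k
    have hk : (0 : ℝ) < 1 / (k + 1 : ℝ) := by positivity
    have h1 : ∀ y' : Y →L[ℝ] ℝ, ∀ᶠ x in (𝒰 : Filter Y), |y' x - ξ y'| < 1 / (k + 1 : ℝ) :=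
      fun y' => (hξ y').eventually (Metric.ball_mem_nhds _ hk)
    have h2 : ∀ᶠ x in (𝒰 : Filter Y), x ∈ F := hF
    exact (h2.and ((h1 b).and ((Filter.eventually_all_finite (Set.finite_Iic k)).2
      fun j _ => h1 (a j)))).exists
  choose x hxF hxb hxa using hx
  have hm : ∀ n : ℕ, ∃ m, ε ≤ s * (ξ (a m) - ξ b) ∧
      ∀ k ∈ Set.Iic n, |a m (x k) - b (x k)| < 1 / (n + 1 : ℝ) := by
    intro n
    have hn : (0 : ℝ) < 1 / (n + 1 : ℝ) := by positivity
    exact (hfar.and ((Filter.eventually_all_finite (Set.finite_Iic n)).2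
      fun k _ => (hab (x k)).eventually (Metric.ball_mem_nhds _ hn))).exists
  choose m hmε hmx using hm
  refine not_iterated_limits_of_attains (Z := F) (f := fun n z => s * a (m n) z)
    (x := fun k => ⟨x k, hxF k⟩) (p := fun n => s * ξ (a (m n))) (r := fun k => s * b (x k))
    (q := s * ξ b) hR hε (fun n z => ?_) ?_ (fun n => ?_) (fun n => ?_) (fun k => ?_) ?_
  · rw [abs_mul, hs, one_mul]
    exact abs_apply_le_of_norm_le_one hD hFR (ha _) z.2
  · intro α g hα c hc
    obtain ⟨𝒲, h𝒲, hc⟩ := mapClusterPt_iff_ultrafilter.1 hc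
    obtain ⟨e, he, hlim⟩ := hDlim (fun n => a (m n)) (fun n => ha _) 𝒲
    have hce : ∀ z : F, c z = s * e z := fun z =>
      tendsto_nhds_unique ((tendsto_pi_nhds.1 hc) z) ((hlim z).const_mul s)
    obtain ⟨x₀, hx₀, hmax⟩ := hatt.attains_sub hD hFR (s := s) hα (fun n => ha (m (g n))) he
    exact ⟨⟨x₀, hx₀⟩, fun z => by rw [hce, hce]; exact hmax z z.2⟩
  · refine (tendsto_of_abs_sub_le_one_div ?_).const_mul s
    exact (eventually_ge_atTop (m n)).mono fun k hk => (hxa k _ hk).le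
  · linarith [hmε n]
  · refine (tendsto_of_abs_sub_le_one_div ?_).const_mul s
    exact (eventually_ge_atTop k).mono fun n hn => (hmx n _ hn).le
  · exact (tendsto_of_abs_sub_le_one_div (Eventually.of_forall fun k => (hxb k).le)).const_mul s

lemma abs_limit_le (hD : ∀ d ∈ D, ‖d‖ ≤ 1) (hFR : ∀ x ∈ F, ‖x‖ ≤ R) (hF : F ∈ 𝒰)
    (hξ : ∀ y' : Y →L[ℝ] ℝ, Tendsto y' 𝒰 (𝓝 (ξ y'))) {d : Y →L[ℝ] ℝ} (hd : d ∈ D) :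
    |ξ d| ≤ R :=
  le_of_tendsto (hξ d).abs
    (Filter.mem_of_superset hF fun _ hx => abs_apply_le_of_norm_le_one hD hFR hd hx)

/-- A limit functional is, on `D` and on one prescribed functional, the limit of a sequence. -/
lemma SeriesAttain.exists_seq_tendsto (hatt : SeriesAttain D F) (hD : ∀ d ∈ D, ‖d‖ ≤ 1)
    (hDlim : HasUltraLimits D) (hR : 0 < R) (hFR : ∀ x ∈ F, ‖x‖ ≤ R) (hF : F ∈ 𝒰)
    (hξ : ∀ y' : Y →L[ℝ] ℝ, Tendsto y' 𝒰 (𝓝 (ξ y'))) (y' : Y →L[ℝ] ℝ) :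
    ∃ x : ℕ → Y, (∀ k, x k ∈ F) ∧ (∀ k, |y' (x k) - ξ y'| < 1 / (k + 1 : ℝ)) ∧
      ∀ d ∈ D, Tendsto (fun k => d (x k)) atTop (𝓝 (ξ d)) := by
  have hnet : ∀ l : List Y, ∃ T ⊆ D, T.Finite ∧ ((∀ z ∈ l, z ∈ F) → ∀ d ∈ D, ∃ a ∈ T,
      |ξ a - ξ d| < 1 / (l.length + 1 : ℝ) ∧ ∀ z ∈ l, |a z - d z| < 1 / (l.length + 1 : ℝ)) := by
    intro l
    by_cases hl : ∀ z ∈ l, z ∈ F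
    · obtain ⟨T, hTD, hT, h⟩ := exists_finite_net (ι := Option (Fin l.length)) (S := D)
        (g := fun i d => i.elim (ξ d) fun i => d l[i]) (K := R) (by
          rintro (_ | i) d hd
          · exact abs_limit_le hD hFR hF hξ hd
          · exact abs_apply_le_of_norm_le_one hD hFR hd (hl _ (List.getElem_mem _)))
        (show (0 : ℝ) < 1 / (l.length + 1 : ℝ) by positivity)
      refine ⟨T, hTD, hT, fun _ d hd => ?_⟩
      obtain ⟨a, ha, had⟩ := h d hd
      refine ⟨a, ha, had none, fun z hz => ?_⟩
      obtain ⟨i, hi, rfl⟩ := List.mem_iff_getElem.1 hz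
      exact had (some ⟨i, hi⟩)
    · exact ⟨∅, Set.empty_subset _, Set.finite_empty, fun h => absurd h hl⟩
  choose net hnetD hnetfin hnet using hnet
  have hstep : ∀ l : List Y, ∃ x ∈ F, |y' x - ξ y'| < 1 / (l.length + 1 : ℝ) ∧
      ∀ a ∈ ⋃ l' ∈ {l' | l' ∈ l.tails}, net l', |a x - ξ a| < 1 / (l.length + 1 : ℝ) := by
    intro l
    have hl : (0 : ℝ) < 1 / (l.length + 1 : ℝ) := by positivity
    have h1 : ∀ y' : Y →L[ℝ] ℝ, ∀ᶠ x in (𝒰 : Filter Y), |y' x - ξ y'| < 1 / (l.length + 1 : ℝ) :=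
      fun y' => (hξ y').eventually (Metric.ball_mem_nhds _ hl)
    have h2 : ∀ᶠ x in (𝒰 : Filter Y), x ∈ F := hF
    have hfin : (⋃ l' ∈ {l' | l' ∈ l.tails}, net l').Finite :=
      (List.finite_toSet _).biUnion fun l' _ => hnetfin l'
    exact (h2.and ((h1 y').and ((Filter.eventually_all_finite hfin).2 fun a _ => h1 a))).exists
  choose nxt hnxtF hnxty hnxta using hstep
  let l : ℕ → List Y := fun n => Nat.rec [] (fun _ l => nxt l :: l) n
  have hl : ∀ n, l (n + 1) = nxt (l n) :: l n := fun n => rfl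
  have hlen : ∀ n, (l n).length = n := fun n => by
    induction n with
    | zero => rfl
    | succ n ih => rw [hl, List.length_cons, ih]
  have hlF : ∀ n, ∀ z ∈ l n, z ∈ F := fun n => by
    induction n with
    | zero => simp [l]
    | succ n ih =>
      rw [hl]
      exact List.forall_mem_cons.2 ⟨hnxtF _, ih⟩
  have hsuff : ∀ {m n}, m ≤ n → l m <:+ l n := fun {m n} h => by
    induction n, h using Nat.le_induction with
    | base => exact List.suffix_rfl
    | succ n _ ih => exact ih.trans (List.suffix_cons _ _)
  let x : ℕ → Y := fun k => nxt (l k)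
  have hxF : ∀ k, x k ∈ F := fun k => hnxtF _
  have hxl : ∀ {k n}, k < n → x k ∈ l n := fun {k n} h =>
    (hsuff (Nat.succ_le_of_lt h)).subset (by rw [hl]; exact List.mem_cons_self)
  have hxnet : ∀ m, ∀ a ∈ net (l m), Tendsto (fun k => a (x k)) atTop (𝓝 (ξ a)) := by
    intro m a ha
    refine tendsto_of_abs_sub_le_one_div ((eventually_ge_atTop m).mono fun k hk => ?_)
    have := hnxta (l k) a (Set.mem_biUnion ((List.mem_tails _ _).2 (hsuff hk)) ha)
    rw [hlen] at this
    exact this.le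
  refine ⟨x, hxF, fun k => by simpa only [hlen] using hnxty (l k), fun d hd => ?_⟩
  refine tendsto_iff_ultrafilter _ _ _ |>.2 fun 𝒲 h𝒲 => ?_
  have hF' : F ∈ 𝒲.map x := Ultrafilter.mem_map.2 (Filter.univ_mem' hxF)
  obtain ⟨υ, hυ⟩ := exists_forall_tendsto_ultrafilter hFR hF'
  have hυ' : ∀ y' : Y →L[ℝ] ℝ, Tendsto (fun k => y' (x k)) 𝒲 (𝓝 (υ y')) := fun y' => hυ y'
  have ha : ∀ m, ∃ a ∈ net (l m), |ξ a - ξ d| < 1 / (m + 1 : ℝ) ∧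
      ∀ z ∈ l m, |a z - d z| < 1 / (m + 1 : ℝ) := fun m => by
    simpa only [hlen] using hnet (l m) (hlF m) d hd
  choose a hanet haξ hax using ha
  have haD : ∀ m, a m ∈ D := fun m => hnetD _ (hanet m)
  obtain ⟨b, hbD, hb⟩ := hDlim a haD (hyperfilter ℕ)
  have hbx : ∀ k, b (x k) = d (x k) := fun k =>
    tendsto_nhds_unique (hb (x k)) <| (tendsto_of_abs_sub_le_one_div
      ((eventually_gt_atTop k).mono fun m hm => (hax m _ (hxl hm)).le)).mono_left
        Nat.hyperfilter_le_atTop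
  have hυb : υ b = υ d := tendsto_nhds_unique (hυ' b) (by simpa only [hbx] using hυ' d)
  have hυa : ∀ m, υ (a m) = ξ (a m) := fun m =>
    tendsto_nhds_unique (hυ' (a m)) ((hxnet m _ (hanet m)).mono_left h𝒲)
  have h1 := hatt.tendsto_of_tendsto hD hDlim hR hFR hF' hυ haD hb
  simp only [hυa] at h1
  have h2 : Tendsto (fun m => ξ (a m)) (hyperfilter ℕ) (𝓝 (ξ d)) :=
    (tendsto_of_abs_sub_le_one_div (Eventually.of_forall fun m => (haξ m).le)).mono_left
      Nat.hyperfilter_le_atTop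
  rw [tendsto_nhds_unique h2 h1, hυb]
  exact hυ' d

lemma HasUltraLimits.exists_isMaxOn (hDlim : HasUltraLimits D) (hDne : D.Nonempty)
    {h : (Y →L[ℝ] ℝ) → ℝ} {K : ℝ} (hK : ∀ d ∈ D, h d ≤ K)
    (hcont : ∀ (a : ℕ → Y →L[ℝ] ℝ) (b : Y →L[ℝ] ℝ) (𝒱 : Ultrafilter ℕ), (∀ n, a n ∈ D) → b ∈ D →
      (∀ y, Tendsto (fun n => a n y) 𝒱 (𝓝 (b y))) → Tendsto (fun n => h (a n)) 𝒱 (𝓝 (h b))) :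
    ∃ b ∈ D, ∀ d ∈ D, h d ≤ h b := by
  have hbdd : BddAbove (h '' D) := ⟨K, by rintro _ ⟨d, hd, rfl⟩; exact hK d hd⟩
  have hseq : ∀ n : ℕ, ∃ d ∈ D, sSup (h '' D) - 1 / (n + 1 : ℝ) < h d := fun n => by
    obtain ⟨_, ⟨d, hd, rfl⟩, hlt⟩ := exists_lt_of_lt_csSup (hDne.image h)
      (sub_lt_self (sSup (h '' D)) (show (0 : ℝ) < 1 / (n + 1 : ℝ) by positivity))
    exact ⟨d, hd, hlt⟩
  choose a haD ha using hseq
  obtain ⟨b, hb, hab⟩ := hDlim a haD (hyperfilter ℕ)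
  refine ⟨b, hb, fun d hd => (le_csSup hbdd ⟨d, hd, rfl⟩).trans ?_⟩
  have h1 : Tendsto (fun n : ℕ => sSup (h '' D) - 1 / (n + 1 : ℝ)) (hyperfilter ℕ)
      (𝓝 (sSup (h '' D))) := by
    simpa using (tendsto_one_div_add_atTop_nhds_zero_nat.const_sub (sSup (h '' D))).mono_left
      Nat.hyperfilter_le_atTop
  exact le_of_tendsto_of_tendsto' h1 (hcont a b _ haD hb hab) fun n => (ha n).le

lemma SeriesAttain.exists_approx [CompleteSpace Y] (hatt : SeriesAttain D F)
    (hD : ∀ d ∈ D, ‖d‖ ≤ 1) (hDlim : HasUltraLimits D) (hR : 0 < R) (hFR : ∀ x ∈ F, ‖x‖ ≤ R)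
    (hF : F ∈ 𝒰) (hξ : ∀ y' : Y →L[ℝ] ℝ, Tendsto y' 𝒰 (𝓝 (ξ y'))) (y' : Y →L[ℝ] ℝ) {η : ℝ}
    (hη : 0 < η) : ∃ w : Y, |y' w - ξ y'| ≤ η ∧ ∀ d ∈ D, |d w - ξ d| ≤ η := by
  obtain ⟨x₀, hx₀F, hx₀y, hx₀⟩ := hatt.exists_seq_tendsto hD hDlim hR hFR hF hξ y'
  obtain ⟨N, hN⟩ := exists_nat_one_div_lt hη
  let x : ℕ → Y := fun k => x₀ (k + N)
  have hxF : ∀ k, x k ∈ F := fun k => hx₀F _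
  have hxy : ∀ k, |y' (x k) - ξ y'| ≤ η := fun k => by
    refine (hx₀y _).le.trans (le_trans ?_ hN.le)
    push_cast
    exact one_div_le_one_div_of_le (by positivity) (by linarith [k.cast_nonneg (α := ℝ)])
  have hx : ∀ d ∈ D, Tendsto (fun k => d (x k)) atTop (𝓝 (ξ d)) := fun d hd =>
    (hx₀ d hd).comp (tendsto_add_atTop_nat N)
  rcases D.eq_empty_or_nonempty with rfl | hDne
  · exact ⟨x 0, hxy 0, fun d hd => hd.elim⟩
  by_contra! hcon
  obtain ⟨d₀, hd₀⟩ := hDne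
  let σ : Bool → ℝ := fun b => if b then 1 else -1
  have hσ : ∀ b, |σ b| = 1 := fun b => by cases b <;> simp [σ]
  let v : ℕ → D × Bool → ℝ := fun k z => σ z.2 * (z.1.1 (x k) - ξ z.1)
  have : Nonempty (D × Bool) := ⟨(⟨d₀, hd₀⟩, true)⟩
  have hvR : ∀ k z, |v k z| ≤ R + R := fun k z => by
    rw [abs_mul, hσ, one_mul]
    exact (abs_sub _ _).trans (add_le_add (abs_apply_le_of_norm_le_one hD hFR z.1.2 (hxF k))
      (abs_limit_le hD hFR hF hξ z.1.2))
  have hrep : ∀ u ∈ tailCombos v 0, ∃ w : Y, |y' w - ξ y'| ≤ η ∧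
      ∀ z, u z = σ z.2 * (z.1.1 w - ξ z.1) := by
    rintro u ⟨lam, h0, -, h1, hu⟩
    have hs : Summable fun k => lam k • x k := by
      refine Summable.of_norm_bounded (h1.summable.mul_right R) fun k => ?_
      rw [norm_smul, Real.norm_of_nonneg (h0 k)]
      exact mul_le_mul_of_nonneg_left (hFR _ (hxF k)) (h0 k)
    have hw : ∀ d : Y →L[ℝ] ℝ,
        HasSum (fun k => lam k * (d (x k) - ξ d)) (d (∑' k, lam k • x k) - ξ d) := fun d => by
      have h := (d.hasSum hs.hasSum).sub (h1.mul_right (ξ d))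
      simpa only [Function.comp_apply, map_smul, smul_eq_mul, one_mul, ← mul_sub] using h
    refine ⟨∑' k, lam k • x k, ?_, fun z => ?_⟩
    · rw [← (hw y').tsum_eq, ← Real.norm_eq_abs]
      have h2 := h1.mul_right η
      rw [one_mul] at h2
      refine tsum_of_norm_bounded h2 fun k => ?_
      rw [norm_mul, Real.norm_of_nonneg (h0 k)]
      exact mul_le_mul_of_nonneg_left (hxy k) (h0 k)
    · refine (hu z).unique ?_
      simpa only [v, mul_left_comm] using (hw z.1).mul_left (σ z.2)
  obtain ⟨u, hu, hmax⟩ := exists_tailCombo_frequently_lt hvR (half_pos hη) (A := η) (by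
    intro u hu B hB
    obtain ⟨w, hwy, hw⟩ := hrep u hu
    obtain ⟨d, hd, hdw⟩ := hcon w hwy
    rcases lt_abs.1 hdw with h | h
    · exact ⟨(⟨d, hd⟩, true), by rw [hw]; simp only [σ, if_true]; linarith⟩
    · exact ⟨(⟨d, hd⟩, false), by rw [hw]; simp [σ]; linarith⟩)
  obtain ⟨w, -, hw⟩ := hrep u hu
  have hmaxσ : ∀ b, ∃ e ∈ D, ∀ d ∈ D, σ b * (d w - ξ d) ≤ σ b * (e w - ξ e) := fun b =>
    hDlim.exists_isMaxOn ⟨d₀, hd₀⟩ (K := R + R)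
      (fun d hd => by
        have := abs_le_of_mem_tailCombos hvR hu (⟨d, hd⟩, b)
        rw [hw] at this
        exact (abs_le.1 this).2)
      fun a e 𝒱 ha he hae => ((hae w).sub
        (hatt.tendsto_of_tendsto hD hDlim hR hFR hF hξ ha hae)).const_mul _
  choose e he hemax using hmaxσ
  obtain ⟨z, hz⟩ : ∃ z, ∀ z', u z' ≤ u z := by
    obtain ⟨b, hb⟩ := Finite.exists_max fun b => u (⟨e b, he b⟩, b)
    refine ⟨(⟨e b, he b⟩, b), fun z' => le_trans ?_ (hb z'.2)⟩
    rw [hw, hw]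
    exact hemax _ _ z'.1.2
  have hlim : Tendsto (fun k => v k z) atTop (𝓝 0) := by
    simpa using ((hx z.1 z.1.2).sub_const (ξ z.1)).const_mul (σ z.2)
  obtain ⟨M, hM⟩ := eventually_atTop.1 (hlim.eventually_lt_const (half_pos hη))
  obtain ⟨n, hn, h⟩ := hmax z hz M
  have := hM n hn
  linarith

lemma SeriesAttain.exists_eq_apply [CompleteSpace Y] (hatt : SeriesAttain D F)
    (hD : ∀ d ∈ D, ‖d‖ ≤ 1) (hDlim : HasUltraLimits D)
    (hDnorm : ∀ y : Y, ∀ η ≥ 0, η < ‖y‖ → ∃ d ∈ D, η < |d y|) (hR : 0 < R)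
    (hFR : ∀ x ∈ F, ‖x‖ ≤ R) (hF : F ∈ 𝒰)
    (hξ : ∀ y' : Y →L[ℝ] ℝ, Tendsto y' 𝒰 (𝓝 (ξ y'))) : ∃ w : Y, ∀ y', ξ y' = y' w := by
  have hle : ∀ {y : Y} {η : ℝ}, 0 ≤ η → (∀ d ∈ D, |d y| ≤ η) → ‖y‖ ≤ η := by
    intro y η hη h
    by_contra! hlt
    obtain ⟨d, hd, hdy⟩ := hDnorm y η hη hlt
    exact absurd (h d hd) (not_le.2 hdy)
  have key : ∀ y' : Y →L[ℝ] ℝ, ∃ w : Y, y' w = ξ y' ∧ ∀ d ∈ D, d w = ξ d := by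
    intro y'
    choose w hwy hwD using fun n : ℕ => hatt.exists_approx hD hDlim hR hFR hF hξ y'
      (show (0 : ℝ) < 1 / (n + 1 : ℝ) by positivity)
    have hcauchy : CauchySeq w := by
      refine cauchySeq_of_le_tendsto_0 (fun n : ℕ => 2 * (1 / (n + 1 : ℝ))) (fun n m N hn hm => ?_)
        (by simpa using tendsto_one_div_add_atTop_nhds_zero_nat.const_mul (2 : ℝ))
      rw [dist_eq_norm]
      refine hle (by positivity) fun d hd => ?_
      have h1 := hwD n d hd
      have h2 := hwD m d hd
      have h3 : 1 / (n + 1 : ℝ) ≤ 1 / (N + 1 : ℝ) :=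
        one_div_le_one_div_of_le (by positivity) (by gcongr)
      have h4 : 1 / (m + 1 : ℝ) ≤ 1 / (N + 1 : ℝ) :=
        one_div_le_one_div_of_le (by positivity) (by gcongr)
      rw [map_sub]
      rw [abs_le] at *
      constructor <;> linarith
    obtain ⟨w₀, hw₀⟩ := cauchySeq_tendsto_of_complete hcauchy
    have hlim : ∀ d : Y →L[ℝ] ℝ, Tendsto (fun n => d (w n)) atTop (𝓝 (d w₀)) := fun d =>
      (d.continuous.tendsto w₀).comp hw₀
    exact ⟨w₀, tendsto_nhds_unique (hlim y')
        (tendsto_of_abs_sub_le_one_div (Eventually.of_forall hwy)),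
      fun d hd => tendsto_nhds_unique (hlim d)
        (tendsto_of_abs_sub_le_one_div (Eventually.of_forall fun n => hwD n d hd))⟩
  choose w hw hwD using key
  refine ⟨w 0, fun y' => ?_⟩
  have : ‖w y' - w 0‖ ≤ 0 := hle le_rfl fun d hd => by
    rw [map_sub, hwD _ d hd, hwD _ d hd]; simp
  rw [← hw y', sub_eq_zero.1 (norm_le_zero_iff.1 this)]

end Dual

/-! ### Weak-star closed sets of functionals -/

section WeakStar

variable {Y : Type*} [NormedAddCommGroup Y] [NormedSpace ℝ Y] {N : Set (Y →L[ℝ] ℝ)}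

lemma subset_wstarClosure_s6 : N ⊆ wstarClosure N :=
  @subset_closure _ (wstarTop Y) N

lemma ultrafilter_le_nhds_wstarTop {𝒰 : Ultrafilter (Y →L[ℝ] ℝ)} {c : Y →L[ℝ] ℝ} :
    (𝒰 : Filter _) ≤ @nhds _ (wstarTop Y) c ↔
      ∀ y, Tendsto (fun f : Y →L[ℝ] ℝ => f y) 𝒰 (𝓝 (c y)) := by
  rw [wstarTop, nhds_induced, ← tendsto_iff_comap, tendsto_pi_nhds]

lemma ultrafilter_le_nhds_weakTop {𝒰 : Ultrafilter Y} {w : Y} :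
    (𝒰 : Filter Y) ≤ @nhds _ (weakTop Y) w ↔ ∀ f : Y →L[ℝ] ℝ, Tendsto f 𝒰 (𝓝 (f w)) := by
  rw [weakTop, nhds_induced, ← tendsto_iff_comap, tendsto_pi_nhds]

lemma continuous_weakTop (y' : Y →L[ℝ] ℝ) : @Continuous Y ℝ (weakTop Y) _ y' := by
  let := weakTop Y
  exact continuous_iff_ultrafilter.2 fun _ _ h => ultrafilter_le_nhds_weakTop.1 h y'

lemma norm_le_one_of_mem_wstarClosure (hN : N ⊆ Metric.closedBall 0 1) {d : Y →L[ℝ] ℝ}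
    (hd : d ∈ wstarClosure N) : ‖d‖ ≤ 1 := by
  let := wstarTop Y
  obtain ⟨𝒰, h𝒰N, h𝒰⟩ := mem_closure_iff_ultrafilter.1 hd
  refine d.opNorm_le_bound zero_le_one fun y => ?_
  refine le_of_tendsto (ultrafilter_le_nhds_wstarTop.1 h𝒰 y).norm
    (Filter.mem_of_superset h𝒰N fun f hf => ?_)
  exact (f.le_opNorm y).trans
    (mul_le_mul_of_nonneg_right (mem_closedBall_zero_iff.1 (hN hf)) (norm_nonneg _))

lemma hasUltraLimits_wstarClosure (hN : N ⊆ Metric.closedBall 0 1) :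
    HasUltraLimits (wstarClosure N) := by
  intro a ha 𝒱
  have hbd : ∀ n y, |a n y| ≤ ‖y‖ := fun n y => by
    simpa using (a n).le_of_opNorm_le (norm_le_one_of_mem_wstarClosure hN (ha n)) y
  have hlim : ∀ y, ∃ l, Tendsto (fun n => a n y) 𝒱 (𝓝 l) := fun y => by
    obtain ⟨l, -, hl⟩ := (isCompact_Icc (a := -‖y‖) (b := ‖y‖)).ultrafilter_le_nhds
      (𝒱.map fun n => a n y) (le_principal_iff.2 <| Filter.mem_map.2 <|
        Filter.univ_mem' fun n => abs_le.1 (hbd n y))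
    exact ⟨l, hl⟩
  choose c hc using hlim
  let b : Y →L[ℝ] ℝ := LinearMap.mkContinuous
    { toFun := c
      map_add' := fun y z => tendsto_nhds_unique (hc (y + z))
        (by simpa only [map_add] using (hc y).add (hc z))
      map_smul' := fun t y => tendsto_nhds_unique (hc (t • y))
        (by simpa only [map_smul, RingHom.id_apply] using (hc y).const_smul t) } 1 fun y => by
      rw [one_mul]
      exact le_of_tendsto (hc y).norm (Eventually.of_forall fun n => hbd n y)
  refine ⟨b, ?_, hc⟩
  let := wstarTop Y
  exact (isClosed_iff_ultrafilter.1 isClosed_closure) b (𝒱.map a)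
    (ultrafilter_le_nhds_wstarTop.2 hc) (Ultrafilter.mem_map.2 (Filter.univ_mem' ha))

lemma exists_lt_abs_apply_of_norming
    (hN : ∀ y : Y, ‖y‖ = sSup ((fun a : Y →L[ℝ] ℝ => |a y|) '' N)) (y : Y) {η : ℝ}
    (hη : 0 ≤ η) (hy : η < ‖y‖) : ∃ d ∈ wstarClosure N, η < |d y| := by
  rcases N.eq_empty_or_nonempty with rfl | hne
  · have := hN y
    rw [Set.image_empty, Real.sSup_empty] at this
    linarith
  · rw [hN] at hy
    obtain ⟨_, ⟨d, hd, rfl⟩, h⟩ := exists_lt_of_lt_csSup (hne.image _) hy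
    exact ⟨d, subset_wstarClosure_s6 hd, h⟩

lemma seriesAttain_of_acoInf_attains [CompleteSpace Y] {D : Set (Y →L[ℝ] ℝ)} {F : Set Y} {R : ℝ}
    (hD : ∀ d ∈ D, ‖d‖ ≤ 1) (hFne : F.Nonempty) (hFR : ∀ x ∈ F, ‖x‖ ≤ R)
    (h : ∀ y' ∈ acoInf D, ∃ f₀ ∈ F, y' f₀ = sSup ((fun f => y' f) '' F)) :
    SeriesAttain D F := by
  intro α u hα hu
  obtain ⟨x₁, hx₁⟩ := hFne
  set s := ∑' n, |α n| with hs
  rcases (tsum_nonneg fun n => abs_nonneg (α n)).eq_or_lt with h0 | hpos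
  · have hα0 : ∀ n, α n = 0 := fun n => by
      have := (hα.hasSum_iff.2 h0.symm)
      exact abs_eq_zero.1 (congrFun ((hasSum_zero_iff_of_nonneg fun n => abs_nonneg (α n)).1 this) n)
    exact ⟨x₁, hx₁, fun x _ => by simp [hα0]⟩
  change 0 < s at hpos
  have hsum : Summable fun n => (α n / s) • u n := by
    refine Summable.of_norm_bounded (hα.div_const s) fun n => ?_
    rw [norm_smul, norm_div, Real.norm_eq_abs, Real.norm_of_nonneg hpos.le]
    exact mul_le_of_le_one_right (by positivity) (hD _ (hu n))
  obtain ⟨x₀, hx₀, hmax⟩ := h (∑' n, (α n / s) • u n)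
    ⟨fun n => α n / s, u, hu, by simpa only [abs_div, abs_of_pos hpos] using hα.div_const s,
      by simp only [abs_div, abs_of_pos hpos, tsum_div_const]; exact div_self hpos.ne',
      hsum.hasSum⟩
  have happly : ∀ x, (∑' n, (α n / s) • u n) x = (∑' n, α n * u n x) / s := fun x => by
    rw [← tsum_div_const]
    refine ((hsum.hasSum.mapL (ContinuousLinearMap.apply ℝ ℝ x)).tsum_eq).symm.trans ?_
    exact tsum_congr fun n => by
      simp only [ContinuousLinearMap.apply_apply, smul_apply, smul_eq_mul]
      ring
  refine ⟨x₀, hx₀, fun x hx => ?_⟩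
  rw [← div_le_div_iff_of_pos_right hpos, ← happly, ← happly, hmax]
  refine le_csSup ⟨‖∑' n, (α n / s) • u n‖ * R, ?_⟩ ⟨x, hx, rfl⟩
  rintro _ ⟨y, hy, rfl⟩
  exact (abs_le.1 (ContinuousLinearMap.abs_apply_le_mul _ hFR hy)).2

end WeakStar

/-- "James2.0": for a norming set `N ⊆ B(Y*)` and a weakly closed
bounded nonempty set `F ⊆ Y`, `F` is weakly compact iff every
`y* ∈ aco_∞(cl_w*(N))` attains its supremum on `F`. -/
theorem stmt6 {Y : Type*} [NormedAddCommGroup Y] [NormedSpace ℝ Y] [CompleteSpace Y]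
    (N : Set (Y →L[ℝ] ℝ)) (hNball : N ⊆ Metric.closedBall 0 1)
    -- `N` is norming for `Y`:
    (hnorming : ∀ y : Y, ‖y‖ = sSup ((fun a : Y →L[ℝ] ℝ => |a y|) '' N))
    (F : Set Y) (hFne : F.Nonempty) (hFbdd : IsBounded F)
    (hFclosed : @IsClosed Y (weakTop Y) F) :
    @IsCompact Y (weakTop Y) F ↔
      ∀ y' ∈ acoInf (wstarClosure N), ∃ f₀ ∈ F, y' f₀ = sSup ((fun f => y' f) '' F) := by
  constructor
  · intro hF y' _
    let := weakTop Y
    obtain ⟨x, hx, h⟩ := hF.exists_sSup_image_eq hFne (continuous_weakTop y').continuousOn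
    exact ⟨x, hx, h.symm⟩
  · intro h
    obtain ⟨R, hR, hFR⟩ := hFbdd.exists_pos_norm_le
    have hD : ∀ d ∈ wstarClosure N, ‖d‖ ≤ 1 := fun d hd => norm_le_one_of_mem_wstarClosure hNball hd
    have hatt := seriesAttain_of_acoInf_attains hD hFne hFR h
    refine @isCompact_iff_ultrafilter_le_nhds _ (weakTop Y) _ |>.2 fun 𝒰 h𝒰 => ?_
    have hF : F ∈ 𝒰 := le_principal_iff.1 h𝒰
    obtain ⟨ξ, hξ⟩ := exists_forall_tendsto_ultrafilter hFR hF
    obtain ⟨w, hw⟩ := hatt.exists_eq_apply hD (hasUltraLimits_wstarClosure hNball)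
      (fun y η hη hy => exists_lt_abs_apply_of_norming hnorming y hη hy) hR hFR hF hξ
    have hlim : (𝒰 : Filter Y) ≤ @nhds _ (weakTop Y) w :=
      ultrafilter_le_nhds_weakTop.2 fun y' => hw y' ▸ hξ y'
    exact ⟨w, (@isClosed_iff_ultrafilter _ _ (weakTop Y)).1 hFclosed w 𝒰 hlim hF, hlim⟩
end
end
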